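/- Let j ∈ {2,…,n-1}, K an origin-symmetric convex body with h_K ∈ C², Ah_K > 0 on S^{n-1}, and z ∈ C²(S^{n-1}). Define the measure dV_K^j := (1/n)h_K·s(h_K[j-1],1[n-j])dH^{n-1} and the operator T_K^j z := z - s(zh_K, h_K[j-2], 1[n-j])/s(h_K[j-1],1[n-j]). Then T_K^j annihilates constants, is symmetric with respect to the L²(V_K^j) inner product, and is positive semi-definite: ⟨z, T_K^j z⟩_{L²(V_K^j)} ≥ 0 for all z ∈ C²(S^{n-1}). -/

import Mathlib

open MeasureTheory Metric Matrix
open scoped RealInnerProductSpace Pointwise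

noncomputable section

abbrev Euc (n : ℕ) := EuclideanSpace ℝ (Fin n)

/-- The support function of a set `K ⊆ ℝⁿ`. -/
def suppFn {n : ℕ} (K : Set (Euc n)) (x : Euc n) : ℝ :=
  sSup ((fun y => ⟪x, y⟫) '' K)

/-- `κ_d`, the volume of the `d`-dimensional Euclidean unit ball. -/
def kappa (d : ℕ) : ℝ := (volume (ball (0 : Euc d) 1)).toReal

/-- The `(n-1)`-dimensional Hausdorff measure on the unit sphere. -/
def sphM (n : ℕ) : Measure (Euc n) := (μH[(n : ℝ) - 1]).restrict (sphere (0 : Euc n) 1)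

/-- The Wulff shape of `f`: the largest convex body whose support function is dominated by `f`. -/
def wulff {n : ℕ} (f : Euc n → ℝ) : Set (Euc n) :=
  {x | ∀ u : Euc n, ‖u‖ = 1 → ⟪x, u⟫ ≤ f u}

/-- The `p`-combination `((1-λ)a^p + λb^p)^{1/p}` (geometric mean for `p = 0`). -/
def combP (p lam a b : ℝ) : ℝ :=
  if p = 0 then a ^ (1 - lam) * b ^ lam
  else ((1 - lam) * a ^ p + lam * b ^ p) ^ (1 / p)

/-- The Hessian matrix (in the standard coordinates of `ℝⁿ`) of `h : ℝⁿ → ℝ` at `u`. -/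
def hessMat {n : ℕ} (h : Euc n → ℝ) (u : Euc n) : Matrix (Fin n) (Fin n) ℝ :=
  Matrix.of fun i k =>
    fderiv ℝ (fun x => fderiv ℝ h x (EuclideanSpace.single k 1)) u (EuclideanSpace.single i 1)

/-- `s_j`: the normalized `j`-th elementary symmetric function of the principal radii of
curvature (for a 1-homogeneous `h`, the `j`-th elementary symmetric function of the eigenvalues
of the full Hessian at `u`, read off the characteristic polynomial). -/
def sjFun (n j : ℕ) (h : Euc n → ℝ) (u : Euc n) : ℝ :=
  (((n - 1).choose j : ℝ))⁻¹ * ((-1 : ℝ) ^ j * ((hessMat h u).charpoly.coeff (n - j)))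

/-- A function `V : ℕ → Set ℝⁿ → ℝ` realizes the intrinsic volumes via the Steiner formula. -/
def steiner (n : ℕ) (V : ℕ → Set (Euc n) → ℝ) : Prop :=
  ∀ K : Set (Euc n), IsCompact K → Convex ℝ K → K.Nonempty → ∀ ρ : ℝ, 0 < ρ →
    (volume (K + closedBall (0 : Euc n) ρ)).toReal
      = ∑ i ∈ Finset.range (n + 1), ρ ^ (n - i) * kappa (n - i) * V i K

/-- The mixed discriminant of `N` symmetric `N×N` matrices (via polarization of `det`). -/
def mixedDisc (N : ℕ) (A : Fin N → Matrix (Fin N) (Fin N) ℝ) : ℝ :=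
  ((N.factorial : ℝ))⁻¹ *
    ∑ S : Finset (Fin N), (-1 : ℝ) ^ (N - S.card) * (∑ i ∈ S, A i).det

/-- The mixed curvature function `s(f₁,…,f_{n-1},u) = D_{n-1}(𝒜f₁(u),…,𝒜f_{n-1}(u))`,
computed for `1`-homogeneous extensions via full Hessians:
`D_{n-1}` of the restrictions to `u^⊥` equals `n·D_n(Hess f₁,…,Hess f_{n-1}, u uᵀ)`. -/
def mixedCurv (n : ℕ) (f : Fin (n - 1) → (Euc n → ℝ)) (u : Euc n) : ℝ :=
  n * mixedDisc n (fun i : Fin n =>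
    if h : (i : ℕ) < n - 1 then hessMat (f ⟨i, h⟩) u
    else Matrix.of fun a b =>
      (EuclideanSpace.equiv (Fin n) ℝ) u a * (EuclideanSpace.equiv (Fin n) ℝ) u b)

/-- The argument list `(h[j-1], 1[n-j])` for the mixed curvature function. -/
def curvList (n j : ℕ) (h : Euc n → ℝ) : Fin (n - 1) → (Euc n → ℝ) :=
  fun i => if (i : ℕ) < j - 1 then h else fun x => ‖x‖

/-- The argument list `(zh, h[j-2], 1[n-j])` for the mixed curvature function. -/
def curvListZ (n j : ℕ) (h z : Euc n → ℝ) : Fin (n - 1) → (Euc n → ℝ) :=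
  fun i => if (i : ℕ) = 0 then (fun x => z x * h x)
    else if (i : ℕ) < j - 1 then h else fun x => ‖x‖

/-- The measure `dV_K^j = (1/n) h_K s(h_K[j-1],1[n-j]) dH^{n-1}` on the sphere. -/
def VKj (n j : ℕ) (h : Euc n → ℝ) : Measure (Euc n) :=
  (sphM n).withDensity fun u =>
    ENNReal.ofReal ((n : ℝ)⁻¹ * h u * mixedCurv n (curvList n j h) u)

/-- The operator `T_K^j z = z - s(zh_K, h_K[j-2], 1[n-j])/s(h_K[j-1],1[n-j])`. -/
def TKj (n j : ℕ) (h z : Euc n → ℝ) (u : Euc n) : ℝ :=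
  z u - mixedCurv n (curvListZ n j h z) u / mixedCurv n (curvList n j h) u

/-- `z` is `C²` away from the origin and `0`-homogeneous (a `C²` function of `S^{n-1}`). -/
def C2Sphere {n : ℕ} (z : Euc n → ℝ) : Prop :=
  ContDiffOn ℝ 2 z {(0 : Euc n)}ᶜ ∧ ∀ c : ℝ, 0 < c → ∀ x, z (c • x) = z x

/-! ### Algebra of mixed discriminants -/

lemma altsum_aux {N : ℕ} (c : Fin N → Fin N) :
    ∑ S : Finset (Fin N), (if ∀ k, c k ∈ S then (-1 : ℝ) ^ (N - S.card) else 0)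
      = if Function.Surjective c then 1 else 0 := by
  have h := Finset.prod_add (fun _ : Fin N => (1 : ℝ))
    (fun i => if i ∈ Set.range c then 0 else (-1 : ℝ)) Finset.univ
  rw [Finset.powerset_univ] at h
  have h1 : ∀ S : Finset (Fin N), (if ∀ k, c k ∈ S then (-1 : ℝ) ^ (N - S.card) else 0)
      = (∏ i ∈ S, (1 : ℝ)) * ∏ i ∈ Finset.univ \ S, (if i ∈ Set.range c then 0 else (-1 : ℝ)) := by
    intro S
    rw [Finset.prod_const_one, one_mul]
    split_ifs with hc
    · rw [Finset.prod_congr rfl (g := fun _ => (-1 : ℝ))]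
      · rw [Finset.prod_const, Finset.card_sdiff_of_subset (Finset.subset_univ _)]
        simp
      · intro i hi
        rw [if_neg]
        rintro ⟨k, rfl⟩
        exact (Finset.mem_sdiff.mp hi).2 (hc k)
    · push Not at hc
      obtain ⟨k, hk⟩ := hc
      symm
      apply Finset.prod_eq_zero (i := c k)
      · simp [hk]
      · simp
  rw [Finset.sum_congr rfl (fun S _ => h1 S), ← h]
  split_ifs with hs
  · apply Finset.prod_eq_one
    intro i _
    simp [hs i]
  · have : ∃ i, i ∉ Set.range c := by
      by_contra hcon
      push Not at hcon
      exact hs hcon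
    obtain ⟨i, hi⟩ := this
    apply Finset.prod_eq_zero (Finset.mem_univ i)
    simp only [if_neg hi]; norm_num

/-- The `i`-th row of a matrix, as a linear map. -/
def rowL (N : ℕ) (i : Fin N) : Matrix (Fin N) (Fin N) ℝ →ₗ[ℝ] (Fin N → ℝ) where
  toFun A := A i
  map_add' _ _ := rfl
  map_smul' _ _ := rfl

/-- The mixed discriminant as a multilinear map. -/
def mdML (N : ℕ) : MultilinearMap ℝ (fun _ : Fin N => Matrix (Fin N) (Fin N) ℝ) ℝ :=
  ((N.factorial : ℝ))⁻¹ • ∑ τ : Equiv.Perm (Fin N), ((Equiv.Perm.sign τ : ℤ) : ℝ) •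
    ((detRowAlternating (n := Fin N) (R := ℝ)).toMultilinearMap.compLinearMap
      (fun k : Fin N => rowL N (τ k)))

lemma mdML_apply (N : ℕ) (A : Fin N → Matrix (Fin N) (Fin N) ℝ) :
    mdML N A = ((N.factorial : ℝ))⁻¹ * ∑ τ : Equiv.Perm (Fin N), ((Equiv.Perm.sign τ : ℤ) : ℝ) *
      (Matrix.of fun k b => A k (τ k) b).det := by
  simp only [mdML, _root_.smul_apply, _root_.sum_apply, smul_eq_mul]
  rfl

lemma mixedDisc_eq (N : ℕ) (A : Fin N → Matrix (Fin N) (Fin N) ℝ) :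
    mixedDisc N A = mdML N A := by
  rw [mdML_apply, mixedDisc]
  congr 1
  have hdet : ∀ S : Finset (Fin N), (∑ i ∈ S, A i).det
      = ∑ c : Fin N → Fin N, if ∀ k, c k ∈ S then (Matrix.of fun k b => A (c k) k b).det else 0 := by
    intro S
    have h := (detRowAlternating (n := Fin N) (R := ℝ)).toMultilinearMap.map_sum_finset
      (fun k i => A i k) (fun _ => S)
    have h2 : (fun k => ∑ i ∈ S, A i k) = (∑ i ∈ S, A i : Matrix (Fin N) (Fin N) ℝ) := by
      ext k b
      simp [Matrix.sum_apply]
    rw [h2] at h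
    refine Eq.trans h ?_
    rw [← Finset.sum_filter]
    apply Finset.sum_congr
    · ext c; simp [Fintype.mem_piFinset]
    · intros; rfl
  simp_rw [hdet, Finset.mul_sum]
  rw [Finset.sum_comm]
  have h3 : ∀ c : Fin N → Fin N, ∑ S : Finset (Fin N), (-1 : ℝ) ^ (N - S.card) *
      (if ∀ k, c k ∈ S then (Matrix.of fun k b => A (c k) k b).det else 0)
      = if Function.Surjective c then (Matrix.of fun k b => A (c k) k b).det else 0 := by
    intro c
    have : ∀ S : Finset (Fin N), (-1 : ℝ) ^ (N - S.card) *
      (if ∀ k, c k ∈ S then (Matrix.of fun k b => A (c k) k b).det else 0)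
      = (if ∀ k, c k ∈ S then (-1 : ℝ) ^ (N - S.card) else 0) *
        (Matrix.of fun k b => A (c k) k b).det := by
      intro S; split_ifs <;> simp
    rw [Finset.sum_congr rfl (fun S _ => this S), ← Finset.sum_mul, altsum_aux]
    split_ifs <;> simp
  rw [Finset.sum_congr rfl (fun c _ => h3 c), ← Finset.sum_filter]
  symm
  refine Finset.sum_bij (fun (τ : Equiv.Perm (Fin N)) _ => (⇑(τ⁻¹) : Fin N → Fin N)) ?_ ?_ ?_ ?_
  · intro τ _
    simpa using (τ⁻¹).surjective
  · intro a _ b _ hab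
    exact inv_injective (DFunLike.coe_injective hab)
  · intro c hc
    have hc' : Function.Surjective c := by simpa using hc
    refine ⟨(Equiv.ofBijective c (Finite.injective_iff_surjective.mpr hc' |> fun h => ⟨h, hc'⟩))⁻¹,
      Finset.mem_univ _, ?_⟩
    simp only [inv_inv]
    rfl
  · intro τ _
    have := det_permute τ (Matrix.of fun k b => A (τ⁻¹ k) k b)
    have h4 : ((Matrix.of fun k b => A (τ⁻¹ k) k b).submatrix τ id)
        = Matrix.of fun k b => A k (τ k) b := by
      ext k b; simp
    rw [h4] at this
    rw [this, ← mul_assoc]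
    have h5 : ((Equiv.Perm.sign τ : ℤ) : ℝ) * ((Equiv.Perm.sign τ : ℤ) : ℝ) = 1 := by
      rcases Int.units_eq_one_or (Equiv.Perm.sign τ) with h | h <;> simp [h]
    rw [h5, one_mul]

lemma md_transpose (N : ℕ) (A : Fin N → Matrix (Fin N) (Fin N) ℝ) :
    mdML N (fun k => (A k)ᵀ) = mdML N A := by
  rw [← mixedDisc_eq, ← mixedDisc_eq, mixedDisc, mixedDisc]
  congr 1
  refine Finset.sum_congr rfl fun S _ => ?_
  rw [← Matrix.det_transpose (∑ i ∈ S, A i), Matrix.transpose_sum]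

lemma md_kill {N : ℕ} (A : Fin N → Matrix (Fin N) (Fin N) ℝ) (u : Fin N → ℝ) (hu : u ≠ 0)
    (h : ∀ k, A k *ᵥ u = 0) : mdML N A = 0 := by
  rw [← mixedDisc_eq, mixedDisc]
  rw [Finset.sum_eq_zero, mul_zero]
  intro S _
  rw [Matrix.exists_mulVec_eq_zero_iff.mp ⟨u, hu, ?_⟩, mul_zero]
  rw [Matrix.sum_mulVec]
  exact Finset.sum_eq_zero fun k _ => h k

/-- If toggling membership of slot `m` does not change the determinants, `md = 0`. -/
lemma md_toggle {N : ℕ} (A : Fin N → Matrix (Fin N) (Fin N) ℝ) (m : Fin N)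
    (h : ∀ S : Finset (Fin N), m ∉ S → (A m + ∑ i ∈ S, A i).det = (∑ i ∈ S, A i).det) :
    mdML N A = 0 := by
  rw [← mixedDisc_eq, mixedDisc]
  have : ∑ S : Finset (Fin N), (-1 : ℝ) ^ (N - S.card) * (∑ i ∈ S, A i).det = 0 := by
    rw [← Finset.powerset_univ, ← Finset.insert_erase (Finset.mem_univ m),
      Finset.sum_powerset_insert (Finset.notMem_erase _ _), ← Finset.sum_add_distrib]
    refine Finset.sum_eq_zero fun S hS => ?_
    have hm : m ∉ S := fun hh => Finset.notMem_erase m _ (Finset.mem_powerset.mp hS hh)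
    rw [Finset.sum_insert hm, h S hm, Finset.card_insert_of_notMem hm]
    have hlt : S.card < N := by
      have := Finset.card_lt_card (Finset.ssubset_univ_iff.mpr
        (fun hh : S = Finset.univ => hm (hh ▸ Finset.mem_univ m)))
      simpa using this
    have : N - S.card = (N - (S.card + 1)) + 1 := by omega
    rw [this, pow_succ]; ring
  rw [this, mul_zero]

lemma md_rankone {N : ℕ} (A : Fin N → Matrix (Fin N) (Fin N) ℝ) (m : Fin N) (u w : Fin N → ℝ)
    (hu : u ≠ 0) (hw : w ⬝ᵥ u = 0) (hm : A m = vecMulVec u w) (c : Fin N → ℝ)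
    (h : ∀ k, k ≠ m → A k *ᵥ u = c k • u) : mdML N A = 0 := by
  apply md_toggle A m
  intro S hS
  set M := ∑ i ∈ S, A i with hM
  have hMu : M *ᵥ u = (∑ i ∈ S, c i) • u := by
    rw [hM, Matrix.sum_mulVec, Finset.sum_smul]
    exact Finset.sum_congr rfl fun k hk => h k (fun hh => hS (hh ▸ hk))
  rw [hm]
  by_cases hc : (∑ i ∈ S, c i) = 0
  · rw [hc, zero_smul] at hMu
    rw [Matrix.exists_mulVec_eq_zero_iff.mp ⟨u, hu, hMu⟩,
      Matrix.exists_mulVec_eq_zero_iff.mp ⟨u, hu, ?_⟩]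
    rw [Matrix.add_mulVec, hMu, Matrix.vecMulVec_mulVec, hw]; simp
  · have : vecMulVec u w + M = M * (1 + vecMulVec ((∑ i ∈ S, c i)⁻¹ • u) w) := by
      rw [mul_add, mul_one, Matrix.mul_vecMulVec, Matrix.mulVec_smul, hMu, smul_smul,
        inv_mul_cancel₀ hc, one_smul, add_comm]
    rw [this, Matrix.det_mul, vecMulVec_eq Unit, Matrix.det_one_add_replicateCol_mul_replicateRow]
    simp [hw]

lemma md_rankone_sq {N : ℕ} (v : Fin N → Fin N → ℝ) :
    mdML N (fun k => vecMulVec (v k) (v k)) = ((N.factorial : ℝ))⁻¹ * (Matrix.of v).det ^ 2 := by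
  rw [mdML_apply]
  congr 1
  have h : ∀ τ : Equiv.Perm (Fin N), (Matrix.of fun k b => vecMulVec (v k) (v k) (τ k) b).det
      = (∏ k, v k (τ k)) * (Matrix.of v).det := by
    intro τ
    rw [← Matrix.det_mul_column]
    rfl
  simp_rw [h, ← mul_assoc, ← Finset.sum_mul]
  rw [sq]
  congr 1
  rw [← Matrix.det_transpose, Matrix.det_apply']
  rfl

lemma md_nonneg {N : ℕ} (A : Fin N → Matrix (Fin N) (Fin N) ℝ) (h : ∀ k, (A k).PosSemidef) :
    0 ≤ mdML N A := by
  choose m v hv using fun k => Matrix.posSemidef_iff_eq_sum_vecMulVec.mp (h k)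
  have : A = fun k => ∑ i, vecMulVec (v k i) (star (v k i)) := funext hv
  rw [this, MultilinearMap.map_sum]
  refine Finset.sum_nonneg fun r _ => ?_
  have := md_rankone_sq (fun k => v k (r k))
  simp only [star_trivial]
  rw [this]
  positivity

lemma md_mono {N : ℕ} (A C : Fin N → Matrix (Fin N) (Fin N) ℝ) (h : ∀ k, (C k).PosSemidef)
    (h' : ∀ k, (A k - C k).PosSemidef) : mdML N C ≤ mdML N A := by
  have : A = C + (A - C) := by simp
  rw [this, MultilinearMap.map_add_univ]
  have h2 : mdML N C = mdML N ((Finset.univ : Finset (Fin N)).piecewise C (A - C)) := by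
    rw [Finset.piecewise_univ]
  rw [h2]
  refine Finset.single_le_sum (f := fun S : Finset (Fin N) => mdML N (S.piecewise C (A - C)))
    (fun S _ => md_nonneg _ fun k => ?_) (Finset.mem_univ _)
  by_cases hk : k ∈ S
  · simpa [hk] using h k
  · simpa [hk] using h' k

lemma md_two_eq {N : ℕ} (A : Fin N → Matrix (Fin N) (Fin N) ℝ) (u : Fin N → ℝ) (k l : Fin N)
    (hkl : k ≠ l) (hk : A k = vecMulVec u u) (hl : A l = vecMulVec u u) : mdML N A = 0 := by
  rw [mdML_apply, Finset.sum_eq_zero, mul_zero]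
  intro τ _
  set M := (Matrix.of fun k b => A k (τ k) b) with hM
  have e1 : M k = u (τ k) • u := by
    ext b; simp [hM, hk, vecMulVec_apply]
  have e2 : M l = u (τ l) • u := by
    ext b; simp [hM, hl, vecMulVec_apply]
  have h1 : M = updateRow M k (u (τ k) • u) := by rw [← e1, updateRow_eq_self]
  rw [h1, det_updateRow_smul]
  set M' := updateRow M k u with hM'
  have h2 : M' = updateRow M' l (u (τ l) • u) := by
    rw [← e2]
    have : M l = M' l := by rw [hM', updateRow_ne hkl.symm]
    rw [this, updateRow_eq_self]
  rw [h2, det_updateRow_smul, det_zero_of_row_eq hkl]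
  · simp
  · rw [updateRow_ne hkl, updateRow_self, hM', updateRow_self]

lemma md_one_trace {N : ℕ} (M : Matrix (Fin N) (Fin N) ℝ) (l : Fin N) :
    mdML N (Function.update (fun _ => 1) l M) = ((N.factorial : ℝ))⁻¹ *
      ∑ τ : Equiv.Perm (Fin N), M (τ l) (τ l) := by
  rw [mdML_apply]
  congr 1
  refine Finset.sum_congr rfl fun τ _ => ?_
  have h := det_permute τ (updateRow (1 : Matrix (Fin N) (Fin N) ℝ) (τ l) (M (τ l)))
  have h2 : (updateRow (1 : Matrix (Fin N) (Fin N) ℝ) (τ l) (M (τ l))).submatrix τ id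
      = Matrix.of fun k b => (Function.update (fun _ => 1) l M : Fin N → Matrix (Fin N) (Fin N) ℝ) k (τ k) b := by
    ext k b
    by_cases hk : k = l
    · subst hk; simp
    · simp [hk, updateRow_ne, Function.update_of_ne hk]
  rw [h2] at h
  rw [h, ← mul_assoc]
  have h5 : ((Equiv.Perm.sign τ : ℤ) : ℝ) * ((Equiv.Perm.sign τ : ℤ) : ℝ) = 1 := by
    rcases Int.units_eq_one_or (Equiv.Perm.sign τ) with h | h <;> simp [h]
  rw [h5, one_mul, ← cramer_transpose_apply, transpose_one, cramer_one]
  rfl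

lemma md_one_pos {N : ℕ} (u : Fin N → ℝ) (hu : u ≠ 0) (l : Fin N) :
    0 < mdML N (Function.update (fun _ => 1) l (vecMulVec u u)) := by
  rw [md_one_trace]
  have : 0 < ∑ τ : Equiv.Perm (Fin N), vecMulVec u u (τ l) (τ l) := by
    obtain ⟨a, ha⟩ := Function.ne_iff.mp hu
    refine Finset.sum_pos' (fun τ _ => ?_) ⟨Equiv.swap l a, Finset.mem_univ _, ?_⟩
    · rw [vecMulVec_apply]; exact mul_self_nonneg _
    · rw [vecMulVec_apply, Equiv.swap_apply_left]
      exact mul_self_pos.mpr ha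
  positivity

lemma exists_lower {N : ℕ} (A : Matrix (Fin N) (Fin N) ℝ) (hA : A.PosDef) :
    ∃ c : ℝ, 0 < c ∧ (A - c • 1).PosSemidef := by
  let q : Euc N → ℝ := fun x => x.ofLp ⬝ᵥ (A *ᵥ x.ofLp)
  have hq : Continuous q := by
    have h1 : Continuous (fun x : Euc N => x.ofLp) := PiLp.continuous_ofLp 2 _
    exact h1.dotProduct (Continuous.matrix_mulVec continuous_const h1)
  have hherm : ∀ c : ℝ, (A - c • 1).IsHermitian := by
    intro c
    refine hA.1.sub ?_
    simp [Matrix.IsHermitian]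
  rcases (sphere (0 : Euc N) 1).eq_empty_or_nonempty with he | hne
  · refine ⟨1, one_pos, Matrix.PosSemidef.of_dotProduct_mulVec_nonneg (hherm 1) fun x => ?_⟩
    have : x = 0 := by
      by_contra hx
      have hx' : WithLp.toLp 2 x ≠ (0 : Euc N) := by simpa using hx
      have : (‖WithLp.toLp 2 x‖⁻¹ • WithLp.toLp 2 x : Euc N) ∈ sphere (0 : Euc N) 1 := by
        simp [norm_smul, hx']
      simp [he] at this
    simp [this]
  · obtain ⟨x0, hx0, hmin⟩ := (isCompact_sphere (0 : Euc N) 1).exists_isMinOn hne hq.continuousOn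
    have hx0' : x0.ofLp ≠ 0 := by
      intro h
      have : x0 = 0 := by ext i; simp [h]
      simp [this] at hx0
    refine ⟨q x0, ?_, Matrix.PosSemidef.of_dotProduct_mulVec_nonneg (hherm _) fun x => ?_⟩
    · simpa using hA.dotProduct_mulVec_pos hx0'
    · by_cases hx : x = 0
      · simp [hx]
      have hx' : WithLp.toLp 2 x ≠ (0 : Euc N) := by simpa using hx
      set r := ‖(WithLp.toLp 2 x : Euc N)‖ with hr
      have hr0 : 0 < r := norm_pos_iff.mpr hx'
      have h1 : (r⁻¹ • WithLp.toLp 2 x : Euc N) ∈ sphere (0 : Euc N) 1 := by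
        simp [norm_smul, ← hr, abs_of_pos hr0, hr0.ne']
      have h2 : q x0 ≤ q (r⁻¹ • WithLp.toLp 2 x) := hmin h1
      have h3 : q (r⁻¹ • WithLp.toLp 2 x) = r⁻¹ * (r⁻¹ * (x ⬝ᵥ (A *ᵥ x))) := by
        simp only [q, WithLp.ofLp_smul, Matrix.mulVec_smul, dotProduct_smul, smul_dotProduct,
          smul_eq_mul]
      have h4 : r ^ 2 = x ⬝ᵥ x := by
        rw [hr, EuclideanSpace.real_norm_sq_eq]
        simp [dotProduct, sq]
      rw [star_trivial, sub_mulVec, dotProduct_sub, smul_mulVec, one_mulVec, dotProduct_smul,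
        smul_eq_mul, ← h4]
      rw [h3] at h2
      have : q x0 * r ^ 2 ≤ r⁻¹ * (r⁻¹ * (x ⬝ᵥ (A *ᵥ x))) * r ^ 2 := by gcongr
      have e : r⁻¹ * (r⁻¹ * (x ⬝ᵥ (A *ᵥ x))) * r ^ 2 = x ⬝ᵥ (A *ᵥ x) := by
        field_simp
      linarith

lemma md_pos {N : ℕ} (A : Fin N → Matrix (Fin N) (Fin N) ℝ) (u : Fin N → ℝ) (hu : u ⬝ᵥ u = 1)
    (l : Fin N) (hl : A l = vecMulVec u u) (hs : ∀ k, k ≠ l → (A k).IsHermitian)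
    (hk : ∀ k, k ≠ l → A k *ᵥ u = 0)
    (hp : ∀ k, k ≠ l → ∀ w : Fin N → ℝ, w ≠ 0 → w ⬝ᵥ u = 0 → 0 < w ⬝ᵥ (A k *ᵥ w)) :
    0 < mdML N A := by
  have hu0 : u ≠ 0 := by rintro rfl; simp at hu
  -- adding `u uᵀ` in the other slots does not change anything
  let B : Fin N → Matrix (Fin N) (Fin N) ℝ := Function.update (fun _ => vecMulVec u u) l 0
  have hAB : mdML N (A + B) = mdML N A := by
    rw [MultilinearMap.map_add_univ, Finset.sum_eq_single Finset.univ]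
    · rw [Finset.piecewise_univ]
    · intro S _ hS
      by_cases hlS : l ∈ S
      · obtain ⟨k, hkS⟩ : ∃ k, k ∉ S := by
          by_contra hcon
          push Not at hcon
          exact hS (Finset.eq_univ_iff_forall.mpr hcon)
        have hkl : k ≠ l := fun hh => hkS (hh ▸ hlS)
        apply md_two_eq _ u k l hkl
        · simp [hkS, B, hkl]
        · simp [hlS, hl]
      · apply MultilinearMap.map_coord_zero _ l
        simp [hlS, B]
    · simp
  rw [← hAB]
  have hPD : ∀ k, k ≠ l → (A k + vecMulVec u u).PosDef := by
    intro k hkl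
    have hH : (vecMulVec u u).IsHermitian := by
      have := (posSemidef_vecMulVec_self_star u).1
      simpa using this
    refine Matrix.PosDef.of_dotProduct_mulVec_pos ((hs k hkl).add hH) fun x hx => ?_
    rw [star_trivial]
    set t := x ⬝ᵥ u with ht
    set w := x - t • u with hw
    have hwu : w ⬝ᵥ u = 0 := by rw [hw, sub_dotProduct, smul_dotProduct, hu]; simp [ht]
    have hx' : x = w + t • u := by simp [hw]
    have hAx : A k *ᵥ x = A k *ᵥ w := by
      rw [hx', mulVec_add, mulVec_smul, hk k hkl]; simp
    have huA : u ⬝ᵥ (A k *ᵥ w) = 0 := by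
      have hT : (A k)ᵀ = A k := by simpa [Matrix.IsHermitian] using hs k hkl
      rw [dotProduct_mulVec, ← mulVec_transpose, hT, hk k hkl, zero_dotProduct]
    have h1 : x ⬝ᵥ (A k *ᵥ x) = w ⬝ᵥ (A k *ᵥ w) := by
      rw [hAx]
      conv_lhs => rw [hx']
      rw [add_dotProduct, smul_dotProduct, huA]; simp
    have h2 : x ⬝ᵥ (vecMulVec u u *ᵥ x) = t ^ 2 := by
      rw [vecMulVec_mulVec, op_smul_eq_smul, dotProduct_smul, dotProduct_comm u x, smul_eq_mul]
      ring
    rw [add_mulVec, dotProduct_add, h1, h2]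
    by_cases hw0 : w = 0
    · have ht0 : t ≠ 0 := by
        intro h
        apply hx
        rw [hx', hw0, h]; simp
      rw [hw0]; simp; positivity
    · have := hp k hkl w hw0 hwu
      positivity
  choose c hc hcp using fun k : {k // k ≠ l} => exists_lower _ (hPD k.1 k.2)
  let c' : Fin N → ℝ := fun k => if h : k ≠ l then c ⟨k, h⟩ else 1
  have hc' : ∀ k, 0 < c' k := by
    intro k; by_cases h : k ≠ l
    · simp only [c', dif_pos h]; exact hc _
    · simp only [c', dif_neg h]; exact one_pos
  have hU : (vecMulVec u u).PosSemidef := by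
      have := (posSemidef_vecMulVec_self_star u)
      simpa using this
  have key : mdML N (fun k => c' k • (Function.update (fun _ => 1) l (vecMulVec u u) :
      Fin N → Matrix (Fin N) (Fin N) ℝ) k) ≤ mdML N (A + B) := by
    apply md_mono
    · intro k
      by_cases h : k = l
      · subst h; simpa using hU.smul (hc' k).le
      · simp only [Function.update_of_ne h]
        exact Matrix.PosSemidef.one.smul (hc' k).le
    · intro k
      by_cases h : k = l
      · subst h
        simp [c', B, hl, Matrix.PosSemidef.zero]
      · have := hcp ⟨k, h⟩
        simpa [c', B, h] using this
  rw [MultilinearMap.map_smul_univ] at key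
  refine lt_of_lt_of_le ?_ key
  exact mul_pos (Finset.prod_pos fun k _ => hc' k) (md_one_pos u hu0 l)

/-! ### `∫ det DF = 0` for compactly supported `C¹` maps -/

lemma det_interp (n : ℕ) (hn : 1 ≤ n) (s : ℝ) (hs : 0 < s) :
    ∃ lam : ℕ → ℝ, (∑ i ∈ Finset.range (n + 1), lam i = 0) ∧
      ∀ L : Euc n →L[ℝ] Euc n, L.det = ∑ i ∈ Finset.range (n + 1),
        lam i * (ContinuousLinearMap.id ℝ (Euc n) + ((i : ℝ) * s) • L).det := by
  classical
  let v : ℕ → ℝ := fun i => (i : ℝ) * s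
  have hv : Set.InjOn v (Finset.range (n + 1)) := by
    intro a _ b _ hab
    have : (a : ℝ) = b := mul_right_cancel₀ hs.ne' hab
    exact_mod_cast this
  refine ⟨fun i => 1 / ∏ j ∈ (Finset.range (n + 1)).erase i, (v i - v j), ?_, ?_⟩
  · have := Lagrange.coeff_eq_sum hv (P := (1 : Polynomial ℝ))
      (by rw [Polynomial.degree_one, Finset.card_range]; exact_mod_cast Nat.succ_pos n)
    rw [Finset.card_range, Polynomial.coeff_one] at this
    simp only [Polynomial.eval_one] at this
    rw [← this, if_neg (by omega)]
  · intro L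
    let b := (EuclideanSpace.basisFun (Fin n) ℝ).toBasis
    set M := LinearMap.toMatrix b b (L : Euc n →ₗ[ℝ] Euc n) with hM
    set P : Polynomial ℝ := det ((Polynomial.X : Polynomial ℝ) • M.map Polynomial.C +
      (1 : Matrix (Fin n) (Fin n) ℝ).map Polynomial.C) with hP
    have hdeg : P.degree < ((Finset.range (n + 1)).card : WithBot ℕ) := by
      rw [Finset.card_range]
      refine lt_of_le_of_lt Polynomial.degree_le_natDegree ?_
      have := Polynomial.natDegree_det_X_add_C_le M 1
      rw [Fintype.card_fin] at this
      exact_mod_cast Nat.lt_succ_of_le this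
    have h := Lagrange.coeff_eq_sum hv hdeg
    have hc := Polynomial.coeff_det_X_add_C_card M 1
    rw [Fintype.card_fin] at hc
    rw [Finset.card_range, Nat.add_sub_cancel, hc] at h
    have hdetL : L.det = M.det := by
      rw [hM, LinearMap.det_toMatrix]
    rw [hdetL, h]
    refine Finset.sum_congr rfl fun i _ => ?_
    have he : P.eval (v i) = (ContinuousLinearMap.id ℝ (Euc n) + ((i : ℝ) * s) • L).det := by
      have h1 : (ContinuousLinearMap.id ℝ (Euc n) + ((i : ℝ) * s) • L).det
          = (1 + v i • M).det := by
        rw [ContinuousLinearMap.det, ← LinearMap.det_toMatrix b]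
        congr 1
        simp [hM, LinearMap.toMatrix_id, v, map_add]
      rw [h1, hP, ← Polynomial.coe_evalRingHom, RingHom.map_det]
      congr 1
      ext a c
      simp [RingHom.mapMatrix_apply, Matrix.map_apply, Matrix.one_apply]
      rw [add_comm]
      congr 1
      · split_ifs <;> simp
      · ring
    rw [he]; ring

lemma integral_det_fderiv_eq_zero (n : ℕ) (hn : 1 ≤ n) (F : Euc n → Euc n) (hF : ContDiff ℝ 1 F)
    (hc : HasCompactSupport F) : ∫ x, (fderiv ℝ F x).det = 0 := by
  have : Nonempty (Fin n) := ⟨⟨0, hn⟩⟩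
  obtain ⟨C, hC⟩ := ContDiff.lipschitzWith_of_hasCompactSupport hc hF one_ne_zero
  have hdF : Continuous (fderiv ℝ F) := hF.continuous_fderiv one_ne_zero
  have hnorm : ∀ x, ‖fderiv ℝ F x‖ ≤ C := fun x => norm_fderiv_le_of_lipschitz ℝ hC
  have hdet : Continuous (fun L : Euc n →L[ℝ] Euc n => L.det) :=
    ContinuousLinearMap.continuous_det
  have hid : (ContinuousLinearMap.id ℝ (Euc n)).det = 1 := by
    simp [ContinuousLinearMap.det]
  obtain ⟨δ, hδ, hδp⟩ : ∃ δ > 0, ∀ L : Euc n →L[ℝ] Euc n, ‖L‖ < δ →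
      0 < (ContinuousLinearMap.id ℝ (Euc n) + L).det := by
    have h1 : ∀ᶠ L in nhds (0 : Euc n →L[ℝ] Euc n),
        0 < (ContinuousLinearMap.id ℝ (Euc n) + L).det := by
      have hcont : Continuous (fun L : Euc n →L[ℝ] Euc n =>
        (ContinuousLinearMap.id ℝ (Euc n) + L).det) := hdet.comp (continuous_const.add continuous_id)
      apply hcont.continuousAt.eventually_const_lt
      simp [hid]
    obtain ⟨δ, hδ, h2⟩ := Metric.eventually_nhds_iff.mp h1
    exact ⟨δ, hδ, fun L hL => h2 (by simpa using hL)⟩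
  -- the ball
  obtain ⟨R, hR⟩ := hc.isCompact.isBounded.subset_ball (0 : Euc n)
  set B := ball (0 : Euc n) R with hB
  have hFB : ∀ x, x ∉ B → F x = 0 := fun x hx => image_eq_zero_of_notMem_tsupport (fun h => hx (hR h))
  have hvol : volume B ≠ ⊤ := measure_ball_lt_top.ne
  -- the volume identity for small `t`
  have key : ∀ t : ℝ, 0 ≤ t → t * C ≤ 1 / 2 → t * C < δ →
      ∫ x in B, (ContinuousLinearMap.id ℝ (Euc n) + t • fderiv ℝ F x).det = (volume B).toReal := by
    intro t ht htC htδ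
    let Φ : Euc n → Euc n := fun x => x + t • F x
    have hA : ApproximatesLinearOn Φ
        ((ContinuousLinearEquiv.refl ℝ (Euc n) : Euc n ≃L[ℝ] Euc n) : Euc n →L[ℝ] Euc n)
        Set.univ (1 / 2 : NNReal) := by
      intro x _ y _
      have : Φ x - Φ y - ((ContinuousLinearEquiv.refl ℝ (Euc n) : Euc n ≃L[ℝ] Euc n) :
          Euc n →L[ℝ] Euc n) (x - y) = t • (F x - F y) := by
        simp only [Φ, ContinuousLinearEquiv.coe_refl, ContinuousLinearMap.id_apply, smul_sub]
        abel
      rw [this, norm_smul, Real.norm_of_nonneg ht]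
      have h3 : ‖F x - F y‖ ≤ C * ‖x - y‖ := hC.norm_sub_le x y
      calc t * ‖F x - F y‖ ≤ t * (C * ‖x - y‖) := by gcongr
        _ = (t * C) * ‖x - y‖ := by ring
        _ ≤ (1 / 2) * ‖x - y‖ := by gcongr
        _ = _ := by simp
    have hlt : Subsingleton (Euc n) ∨ (1 / 2 : NNReal) <
        ‖((ContinuousLinearEquiv.refl ℝ (Euc n)).symm : Euc n →L[ℝ] Euc n)‖₊⁻¹ := by
      right
      have : ‖((ContinuousLinearEquiv.refl ℝ (Euc n)).symm : Euc n →L[ℝ] Euc n)‖₊ = 1 := by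
        ext
        simp
      rw [this, inv_one]
      rw [div_lt_iff₀ (by norm_num)]; norm_num
    have hinj : Function.Injective Φ := by
      have := hA.injective hlt
      intro x y hxy
      have := @this ⟨x, Set.mem_univ _⟩ ⟨y, Set.mem_univ _⟩ hxy
      simpa using this
    have hsurj : Function.Surjective Φ := hA.surjective hlt
    have hout : ∀ x, x ∉ B → Φ x = x := fun x hx => by simp [Φ, hFB x hx]
    have himg : Φ '' B = B := by
      ext y
      constructor
      · rintro ⟨x, hx, rfl⟩
        by_contra hy
        have := hinj (hout _ hy)
        rw [this] at hy
        exact hy hx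
      · intro hy
        obtain ⟨x, rfl⟩ := hsurj y
        refine ⟨x, ?_, rfl⟩
        by_contra hx
        rw [hout x hx] at hy
        exact hx hy
    have hder : ∀ x ∈ B, HasFDerivWithinAt Φ
        (ContinuousLinearMap.id ℝ (Euc n) + t • fderiv ℝ F x) B x := by
      intro x _
      have h1 : HasFDerivAt F (fderiv ℝ F x) x := (hF.differentiable one_ne_zero x).hasFDerivAt
      exact ((hasFDerivAt_id x).add (h1.const_smul t)).hasFDerivWithinAt
    have hcv := integral_image_eq_integral_abs_det_fderiv_smul volume measurableSet_ball hder
      hinj.injOn (fun _ => (1 : ℝ))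
    rw [himg] at hcv
    simp only [smul_eq_mul, mul_one, integral_const] at hcv
    have habs : ∀ x, |(ContinuousLinearMap.id ℝ (Euc n) + t • fderiv ℝ F x).det|
        = (ContinuousLinearMap.id ℝ (Euc n) + t • fderiv ℝ F x).det := by
      intro x
      apply abs_of_pos
      apply hδp
      rw [norm_smul, Real.norm_of_nonneg ht]
      exact lt_of_le_of_lt (by gcongr; exact hnorm x) htδ
    simp_rw [habs] at hcv
    rw [← hcv]
    simp [Measure.real]
  -- choose the step
  obtain ⟨s, hs, hs1, hs2⟩ : ∃ s : ℝ, 0 < s ∧ (n * s) * C ≤ 1 / 2 ∧ (n * s) * C < δ := by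
    refine ⟨min (1 / 2) (δ / 2) / (n * C + 1), by positivity, ?_, ?_⟩
    · have h0 : (0 : ℝ) ≤ n * C := by positivity
      have : (n : ℝ) * (min (1 / 2) (δ / 2) / (n * C + 1)) * C
          = min (1 / 2) (δ / 2) * ((n * C) / (n * C + 1)) := by ring
      rw [this]
      have h1 : (n * C) / (n * C + 1) ≤ (1 : ℝ) := by
        rw [div_le_one (by positivity)]; linarith
      calc _ ≤ min (1 / 2) (δ / 2) * 1 := by gcongr
        _ ≤ 1 / 2 := by rw [mul_one]; exact min_le_left _ _
    · have h0 : (0 : ℝ) ≤ n * C := by positivity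
      have : (n : ℝ) * (min (1 / 2) (δ / 2) / (n * C + 1)) * C
          = min (1 / 2) (δ / 2) * ((n * C) / (n * C + 1)) := by ring
      rw [this]
      have h1 : (n * C) / (n * C + 1) ≤ (1 : ℝ) := by
        rw [div_le_one (by positivity)]; linarith
      calc _ ≤ min (1 / 2) (δ / 2) * 1 := by gcongr
        _ ≤ δ / 2 := by rw [mul_one]; exact min_le_right _ _
        _ < δ := by linarith
  obtain ⟨lam, hlam0, hlam⟩ := det_interp n hn s hs
  have hIntg : ∀ t : ℝ, IntegrableOn
      (fun x => (ContinuousLinearMap.id ℝ (Euc n) + t • fderiv ℝ F x).det) B := by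
    intro t
    have hcont : Continuous (fun x => (ContinuousLinearMap.id ℝ (Euc n) + t • fderiv ℝ F x).det) :=
      hdet.comp (continuous_const.add (hdF.const_smul t))
    exact (hcont.continuousOn.integrableOn_compact
      (isCompact_closedBall (0 : Euc n) R)).mono_set ball_subset_closedBall
  have hsupp : ∫ x, (fderiv ℝ F x).det = ∫ x in B, (fderiv ℝ F x).det := by
    symm
    apply setIntegral_eq_integral_of_forall_compl_eq_zero
    intro x hx
    have : fderiv ℝ F x = 0 := by
      apply image_eq_zero_of_notMem_tsupport
      intro h
      exact hx (hR (tsupport_fderiv_subset ℝ h))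
    rw [this]
    simp [ContinuousLinearMap.det]
  rw [hsupp]
  simp_rw [fun x => hlam (fderiv ℝ F x)]
  rw [integral_finsetSum]
  · have : ∀ i ∈ Finset.range (n + 1), ∫ x in B, lam i *
        (ContinuousLinearMap.id ℝ (Euc n) + ((i : ℝ) * s) • fderiv ℝ F x).det
        = lam i * (volume B).toReal := by
      intro i hi
      rw [integral_const_mul, key]
      · positivity
      · refine le_trans ?_ hs1
        have : (i : ℝ) ≤ n := by exact_mod_cast Nat.lt_succ_iff.mp (Finset.mem_range.mp hi)
        gcongr
      · refine lt_of_le_of_lt ?_ hs2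
        have : (i : ℝ) ≤ n := by exact_mod_cast Nat.lt_succ_iff.mp (Finset.mem_range.mp hi)
        gcongr
    rw [Finset.sum_congr rfl this, ← Finset.sum_mul, hlam0, zero_mul]
  · intro i _
    exact (hIntg _).const_mul _

/-! ### Calculus of Hessian matrices -/

/-- partial derivative -/
def pd {n : ℕ} (k : Fin n) (f : Euc n → ℝ) (x : Euc n) : ℝ :=
  fderiv ℝ f x (EuclideanSpace.single k 1)

/-- gradient vector -/
def gradv {n : ℕ} (f : Euc n → ℝ) (x : Euc n) : Fin n → ℝ := fun k => pd k f x

lemma hessMat_apply {n : ℕ} (f : Euc n → ℝ) (x : Euc n) (i k : Fin n) :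
    hessMat f x i k = pd i (pd k f) x := rfl

lemma euc_sum {n : ℕ} (v : Euc n) : v = ∑ i, v i • EuclideanSpace.single i (1 : ℝ) := by
  ext j
  simp [Finset.sum_apply, Pi.single_apply]

lemma fderiv_eq_grad {n : ℕ} (f : Euc n → ℝ) (x v : Euc n) :
    fderiv ℝ f x v = gradv f x ⬝ᵥ v.ofLp := by
  conv_lhs => rw [euc_sum v]
  rw [map_sum]
  simp only [dotProduct, map_smul, smul_eq_mul, gradv, pd]
  exact Finset.sum_congr rfl fun i _ => mul_comm _ _

lemma pd_congr {n : ℕ} {f g : Euc n → ℝ} {x : Euc n} (h : f =ᶠ[nhds x] g) (k : Fin n) :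
    pd k f x = pd k g x := by
  simp only [pd, h.fderiv_eq]

lemma gradv_congr {n : ℕ} {f g : Euc n → ℝ} {x : Euc n} (h : f =ᶠ[nhds x] g) :
    gradv f x = gradv g x := funext fun k => pd_congr h k

lemma hessMat_congr {n : ℕ} {f g : Euc n → ℝ} {x : Euc n} (h : f =ᶠ[nhds x] g) :
    hessMat f x = hessMat g x := by
  ext i k
  rw [hessMat_apply, hessMat_apply]
  apply pd_congr
  filter_upwards [h.eventuallyEq_nhds] with y hy using pd_congr hy k

lemma contDiffAt_pd {n : ℕ} {f : Euc n → ℝ} {x : Euc n} (hf : ContDiffAt ℝ 2 f x) (k : Fin n) :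
    ContDiffAt ℝ 1 (pd k f) x := by
  have h : ContDiffAt ℝ 1 (fderiv ℝ f) x := hf.fderiv_right (by norm_num)
  exact h.clm_apply contDiffAt_const

lemma pd_mul {n : ℕ} {a b : Euc n → ℝ} {x : Euc n} (ha : DifferentiableAt ℝ a x)
    (hb : DifferentiableAt ℝ b x) (k : Fin n) :
    pd k (fun y => a y * b y) x = a x * pd k b x + b x * pd k a x := by
  simp only [pd]
  rw [fderiv_fun_mul ha hb]
  simp

lemma pd_add {n : ℕ} {a b : Euc n → ℝ} {x : Euc n} (ha : DifferentiableAt ℝ a x)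
    (hb : DifferentiableAt ℝ b x) (k : Fin n) :
    pd k (fun y => a y + b y) x = pd k a x + pd k b x := by
  simp only [pd]
  rw [fderiv_fun_add ha hb]
  simp

lemma gradv_mul {n : ℕ} {a b : Euc n → ℝ} {x : Euc n} (ha : DifferentiableAt ℝ a x)
    (hb : DifferentiableAt ℝ b x) :
    gradv (fun y => a y * b y) x = a x • gradv b x + b x • gradv a x := by
  ext k
  simp [gradv, pd_mul ha hb]

lemma hessMat_mul {n : ℕ} {a b : Euc n → ℝ} {x : Euc n} (ha : ContDiffAt ℝ 2 a x)
    (hb : ContDiffAt ℝ 2 b x) :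
    hessMat (fun y => a y * b y) x = a x • hessMat b x + b x • hessMat a x
      + vecMulVec (gradv a x) (gradv b x) + vecMulVec (gradv b x) (gradv a x) := by
  have ha1 := ha.differentiableAt (by norm_num)
  have hb1 := hb.differentiableAt (by norm_num)
  ext i k
  have h1 : pd k (fun y => a y * b y) =ᶠ[nhds x] fun y => a y * pd k b y + b y * pd k a y := by
    filter_upwards [ha.eventually (by simp), hb.eventually (by simp)] with y hay hby
    exact pd_mul (hay.differentiableAt (by norm_num)) (hby.differentiableAt (by norm_num)) k
  rw [hessMat_apply, pd_congr h1]
  have hpa := (contDiffAt_pd ha k).differentiableAt (by norm_num)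
  have hpb := (contDiffAt_pd hb k).differentiableAt (by norm_num)
  rw [pd_add (ha1.fun_mul hpb) (hb1.fun_mul hpa), pd_mul ha1 hpb, pd_mul hb1 hpa]
  simp [hessMat_apply, vecMulVec_apply, gradv]
  ring

lemma hessMat_const {n : ℕ} (c : ℝ) (x : Euc n) : hessMat (fun _ => c) x = 0 := by
  ext i k
  have : pd k (fun _ : Euc n => c) = fun _ => 0 := by
    ext y; simp [pd]
  rw [hessMat_apply, this]
  simp [pd]

lemma gradv_const {n : ℕ} (c : ℝ) (x : Euc n) : gradv (fun _ => c) x = 0 := by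
  ext k
  simp [gradv, pd]

lemma hessMat_const_mul {n : ℕ} (c : ℝ) {f : Euc n → ℝ} {x : Euc n} (hf : ContDiffAt ℝ 2 f x) :
    hessMat (fun y => c * f y) x = c • hessMat f x := by
  rw [hessMat_mul contDiffAt_const hf, hessMat_const, gradv_const]
  simp

lemma hessMat_fderiv2 {n : ℕ} {f : Euc n → ℝ} {x : Euc n} (hf : ContDiffAt ℝ 2 f x)
    (i k : Fin n) : hessMat f x i k
      = fderiv ℝ (fderiv ℝ f) x (EuclideanSpace.single i 1) (EuclideanSpace.single k 1) := by
  have h : DifferentiableAt ℝ (fderiv ℝ f) x :=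
    (hf.fderiv_right (m := 1) (by norm_num)).differentiableAt (by norm_num)
  have h2 := fderiv_clm_apply h
    (differentiableAt_const (EuclideanSpace.single k (1:ℝ)) : DifferentiableAt ℝ (fun _ : Euc n => (EuclideanSpace.single k (1:ℝ) : Euc n)) x)
  change fderiv ℝ (fun y => fderiv ℝ f y (EuclideanSpace.single k 1)) x _ = _
  rw [h2]
  simp

lemma hessMat_symm {n : ℕ} {f : Euc n → ℝ} {x : Euc n} (hf : ContDiffAt ℝ 2 f x) :
    (hessMat f x)ᵀ = hessMat f x := by
  ext i k
  rw [transpose_apply, hessMat_fderiv2 hf, hessMat_fderiv2 hf]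
  exact (hf.isSymmSndFDerivAt (by simp)).eq _ _

lemma gradv_continuousOn {n : ℕ} {f : Euc n → ℝ} {s : Set (Euc n)} (hs : IsOpen s)
    (hf : ContDiffOn ℝ 2 f s) : ContinuousOn (gradv f) s := by
  apply continuousOn_pi.mpr
  intro k x hx
  exact (contDiffAt_pd (hf.contDiffAt (hs.mem_nhds hx)) k).continuousAt.continuousWithinAt

lemma hessMat_continuousOn {n : ℕ} {f : Euc n → ℝ} {s : Set (Euc n)} (hs : IsOpen s)
    (hf : ContDiffOn ℝ 2 f s) : ContinuousOn (hessMat f) s := by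
  apply continuousOn_pi.mpr
  intro i
  apply continuousOn_pi.mpr
  intro k x hx
  have h := contDiffAt_pd (hf.contDiffAt (hs.mem_nhds hx)) k
  have h2 : ContDiffAt ℝ 0 (fderiv ℝ (pd k f)) x := h.fderiv_right (by norm_num)
  exact (h2.continuousAt.clm_apply continuousAt_const).continuousWithinAt

/-! homogeneity -/

lemma pd_scale {n : ℕ} {g : Euc n → ℝ} {c κ : ℝ} (hc : c ≠ 0)
    (hg : ∀ x, g (c • x) = κ * g x) (k : Fin n) (x : Euc n) :
    pd k g (c • x) = (c⁻¹ * κ) * pd k g x := by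
  have h1 : fderiv ℝ (fun y => g (c • y)) x = c • fderiv ℝ g (c • x) := fderiv_comp_smul c 
  have h2 : (fun y => g (c • y)) = fun y => κ • g y := funext fun y => hg y
  rw [h2] at h1
  have h3 : fderiv ℝ (fun y => κ • g y) x = κ • fderiv ℝ g x := by
    exact congrFun (fderiv_const_smul_field (𝕜 := ℝ) (f := g) κ) x
  rw [h3] at h1
  have h4 := congrArg (fun L => L (EuclideanSpace.single k 1)) h1
  simp only [_root_.smul_apply, smul_eq_mul] at h4
  simp only [pd]
  rw [mul_assoc, eq_inv_mul_iff_mul_eq₀ hc, h4]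

/-- 1-homogeneous -/
def Hom1 {n : ℕ} (f : Euc n → ℝ) : Prop := ∀ c : ℝ, 0 < c → ∀ x, f (c • x) = c * f x

lemma hom1_pd {n : ℕ} {f : Euc n → ℝ} (hf : Hom1 f) (k : Fin n) {c : ℝ} (hc : 0 < c) (x : Euc n) :
    pd k f (c • x) = pd k f x := by
  rw [pd_scale hc.ne' (hf c hc), inv_mul_cancel₀ hc.ne', one_mul]

lemma hom1_hess_scale {n : ℕ} {f : Euc n → ℝ} (hf : Hom1 f) {c : ℝ} (hc : 0 < c) (x : Euc n) :
    hessMat f (c • x) = c⁻¹ • hessMat f x := by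
  ext i k
  rw [hessMat_apply, pd_scale (κ := 1) hc.ne' (fun y => by rw [hom1_pd hf k hc, one_mul])]
  simp [hessMat_apply]

lemma radial_deriv {n : ℕ} {f : Euc n → ℝ} {x : Euc n} (hf : DifferentiableAt ℝ f x) (φ : ℝ → ℝ)
    (φ' : ℝ) (hφ : HasDerivAt φ φ' 1) (h : ∀ c > 0, f (c • x) = φ c) :
    gradv f x ⬝ᵥ x.ofLp = φ' := by
  rw [← fderiv_eq_grad]
  have hf' : DifferentiableAt ℝ f ((1:ℝ) • x) := by rwa [one_smul]
  have h1 : HasDerivAt (fun c : ℝ => f (c • x)) (fderiv ℝ f ((1:ℝ) • x) ((1:ℝ) • x)) 1 :=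
    hf'.hasFDerivAt.comp_hasDerivAt 1 ((hasDerivAt_id (1:ℝ)).smul_const x)
  rw [one_smul] at h1
  refine h1.unique (hφ.congr_of_eventuallyEq ?_)
  filter_upwards [lt_mem_nhds (zero_lt_one)] with c hc using h c hc

lemma hom1_euler {n : ℕ} {f : Euc n → ℝ} (hf : Hom1 f) {x : Euc n} (hd : DifferentiableAt ℝ f x) :
    gradv f x ⬝ᵥ x.ofLp = f x := by
  refine radial_deriv hd (fun c => c * f x) _ ?_ (fun c hc => hf c hc x)
  simpa using (hasDerivAt_id (1:ℝ)).mul_const (f x)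

lemma hom0_euler {n : ℕ} {f : Euc n → ℝ} {x : Euc n} (hf : ∀ c : ℝ, c > 0 → f (c • x) = f x)
    (hd : DifferentiableAt ℝ f x) : gradv f x ⬝ᵥ x.ofLp = 0 :=
  radial_deriv hd (fun _ => f x) _ (hasDerivAt_const _ _) hf

lemma hom1_hess_kill {n : ℕ} {f : Euc n → ℝ} (hf : Hom1 f) {x : Euc n} (hd : ContDiffAt ℝ 2 f x) :
    hessMat f x *ᵥ x.ofLp = 0 := by
  rw [← hessMat_symm hd, mulVec_transpose]
  ext k
  have := hom0_euler (f := pd k f) (x := x) (fun c hc => hom1_pd hf k hc x)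
    ((contDiffAt_pd hd k).differentiableAt (by norm_num))
  rw [dotProduct_comm] at this
  exact this

/-! norm -/

lemma norm_hom1 {n : ℕ} : Hom1 (fun x : Euc n => ‖x‖) := fun c hc x => by
  simp only [norm_smul, Real.norm_of_nonneg hc.le]

lemma hessMat_normsq {n : ℕ} (x : Euc n) :
    hessMat (fun y : Euc n => ‖y‖ ^ 2) x = (2 : ℝ) • (1 : Matrix (Fin n) (Fin n) ℝ) := by
  ext i k
  have h : pd k (fun y : Euc n => ‖y‖ ^ 2) = fun y => 2 * y k := by
    ext y
    simp only [pd]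
    rw [(hasStrictFDerivAt_norm_sq y).hasFDerivAt.fderiv]
    simp [EuclideanSpace.inner_single_right]
  rw [hessMat_apply, h]
  simp only [pd]
  have h3 : HasFDerivAt (fun y : Euc n => 2 * y k) ((2:ℝ) • (EuclideanSpace.proj k : Euc n →L[ℝ] ℝ)) x :=
    ((EuclideanSpace.proj k : Euc n →L[ℝ] ℝ).hasFDerivAt (x := x)).const_mul 2
  rw [h3.fderiv]
  simp [Matrix.one_apply, Pi.single_apply, eq_comm]

lemma gradv_normsq {n : ℕ} (x : Euc n) : gradv (fun y : Euc n => ‖y‖ ^ 2) x = (2:ℝ) • x.ofLp := by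
  ext k
  simp only [gradv, pd]
  rw [(hasStrictFDerivAt_norm_sq x).hasFDerivAt.fderiv]
  simp [EuclideanSpace.inner_single_right]

lemma gradv_normsq_comp {n : ℕ} {φ : ℝ → ℝ} (hφ : Differentiable ℝ φ) (x : Euc n) :
    ∃ c : ℝ, gradv (fun y : Euc n => φ (‖y‖ ^ 2)) x = c • x.ofLp := by
  refine ⟨deriv φ (‖x‖ ^ 2) * 2, ?_⟩
  have h := ((hφ (‖x‖^2)).hasDerivAt.comp_hasFDerivAt x (hasStrictFDerivAt_norm_sq x).hasFDerivAt)
  ext k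
  simp only [gradv, pd]
  have h2 := h.fderiv
  simp only [Function.comp_def] at h2
  rw [h2]
  simp [EuclideanSpace.inner_single_right]
  ring

lemma norm_hess_quad {n : ℕ} {u : Euc n} (hu : ‖u‖ = 1) (w : Fin n → ℝ) (hw : w ⬝ᵥ u.ofLp = 0) :
    w ⬝ᵥ (hessMat (fun x : Euc n => ‖x‖) u *ᵥ w) = w ⬝ᵥ w := by
  have hu0 : u ≠ 0 := by rintro rfl; simp at hu
  have hN : ContDiffAt ℝ 2 (fun x : Euc n => ‖x‖) u := contDiffAt_norm ℝ hu0
  have h := hessMat_mul hN hN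
  have h2 := gradv_mul (hN.differentiableAt (by norm_num)) (hN.differentiableAt (by norm_num))
  have e : (fun y : Euc n => ‖y‖ * ‖y‖) = fun y => ‖y‖ ^ 2 := by ext y; ring
  rw [e, hessMat_normsq, hu] at h
  rw [e, gradv_normsq, hu] at h2
  have h3 : gradv (fun x : Euc n => ‖x‖) u = u.ofLp := by
    ext k
    have := congrFun h2 k
    simp at this
    linarith
  rw [h3] at h
  have h4 := congrArg (fun M => w ⬝ᵥ (M *ᵥ w)) h
  simp only [add_mulVec, one_smul, dotProduct_add, smul_mulVec, dotProduct_smul, one_mulVec,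
    vecMulVec_mulVec] at h4
  rw [dotProduct_comm u.ofLp w, hw] at h4
  simp at h4
  linarith

/-! ### Integration by parts -/

lemma md_continuous (N : ℕ) : Continuous (fun A : Fin N → Matrix (Fin N) (Fin N) ℝ => mdML N A) := by
  simp only [mdML_apply]
  refine continuous_const.mul (continuous_finsetSum _ fun τ _ => continuous_const.mul ?_)
  apply Continuous.matrix_det
  refine continuous_matrix fun k b => ?_
  exact (continuous_apply_apply (τ k) b).comp (continuous_apply k)

lemma det_fderiv_eq {n : ℕ} {F : Euc n → Euc n} {x : Euc n} (hF : DifferentiableAt ℝ F x) :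
    (fderiv ℝ F x).det = (Matrix.of fun k b => pd b (fun y => F y k) x).det := by
  let b := (EuclideanSpace.basisFun (Fin n) ℝ).toBasis
  rw [ContinuousLinearMap.det, ← LinearMap.det_toMatrix b]
  congr 1
  ext k c
  have h : fderiv ℝ (fun y => F y k) x
      = (EuclideanSpace.proj k : Euc n →L[ℝ] ℝ).comp (fderiv ℝ F x) := by
    exact ((EuclideanSpace.proj k : Euc n →L[ℝ] ℝ).hasFDerivAt.comp x hF.hasFDerivAt).fderiv
  simp only [Matrix.of_apply, pd, h]
  simp [LinearMap.toMatrix_apply, b]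

lemma hasCompactSupport_pd {n : ℕ} {f : Euc n → ℝ} (hf : HasCompactSupport f) (k : Fin n) :
    HasCompactSupport (pd k f) := by
  have := hf.fderiv (𝕜 := ℝ)
  exact this.comp_left (g := fun L : Euc n →L[ℝ] ℝ => L (EuclideanSpace.single k 1)) (by simp)

lemma contDiff_pd {n : ℕ} {f : Euc n → ℝ} (hf : ContDiff ℝ 2 f) (k : Fin n) :
    ContDiff ℝ 1 (pd k f) :=
  contDiff_iff_contDiffAt.mpr fun _ => contDiffAt_pd hf.contDiffAt k

lemma hessMat_cont {n : ℕ} {f : Euc n → ℝ} (hf : ContDiff ℝ 2 f) : Continuous (hessMat f) := by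
  rw [← continuousOn_univ]
  exact hessMat_continuousOn isOpen_univ hf.contDiffOn

lemma gradv_cont {n : ℕ} {f : Euc n → ℝ} (hf : ContDiff ℝ 2 f) : Continuous (gradv f) := by
  rw [← continuousOn_univ]
  exact gradv_continuousOn isOpen_univ hf.contDiffOn

lemma ibp_aux (n : ℕ) (hn : 1 ≤ n) (f g : Euc n → ℝ) (H : Fin n → Euc n → ℝ) (i0 : Fin n)
    (hf : ContDiff ℝ 2 f) (hg : ContDiff ℝ 2 g) (hH : ∀ k, ContDiff ℝ 2 (H k))
    (hfc : HasCompactSupport f) (hgc : HasCompactSupport g) (hHc : ∀ k, HasCompactSupport (H k)) :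
    ∫ x, mdML n (Function.update (fun k => hessMat (H k) x) i0
      (f x • hessMat g x + vecMulVec (gradv g x) (gradv f x))) = 0 := by
  let Fc : Equiv.Perm (Fin n) → Fin n → Euc n → ℝ := fun τ k =>
    if k = i0 then fun x => f x * pd (τ i0) g x else pd (τ k) (H k)
  let F : Equiv.Perm (Fin n) → Euc n → Euc n := fun τ x => WithLp.toLp 2 fun k => Fc τ k x
  have hFc : ∀ τ k, ContDiff ℝ 1 (Fc τ k) := by
    intro τ k
    simp only [Fc]
    split_ifs
    · exact (hf.of_le (by norm_num)).mul (contDiff_pd hg _)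
    · exact contDiff_pd (hH k) _
  have hFcc : ∀ τ k, HasCompactSupport (Fc τ k) := by
    intro τ k
    simp only [Fc]
    split_ifs
    · exact hfc.mul_right
    · exact hasCompactSupport_pd (hHc k) _
  have hF : ∀ τ, ContDiff ℝ 1 (F τ) := fun τ => contDiff_euclidean.mpr fun k => hFc τ k
  have hFs : ∀ τ, HasCompactSupport (F τ) := by
    intro τ
    have hK : IsCompact (⋃ k, tsupport (Fc τ k)) := isCompact_iUnion fun k => hFcc τ k
    refine HasCompactSupport.intro hK fun x hx => ?_
    ext k
    simp only [Set.mem_iUnion, not_exists] at hx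
    simpa [F] using image_eq_zero_of_notMem_tsupport (hx k)
  have hpt : ∀ x, mdML n (Function.update (fun k => hessMat (H k) x) i0
      (f x • hessMat g x + vecMulVec (gradv g x) (gradv f x)))
      = ((n.factorial : ℝ))⁻¹ * ∑ τ : Equiv.Perm (Fin n),
        ((Equiv.Perm.sign τ : ℤ) : ℝ) * (fderiv ℝ (F τ) x).det := by
    intro x
    rw [mdML_apply]
    congr 1
    refine Finset.sum_congr rfl fun τ _ => ?_
    congr 1
    rw [det_fderiv_eq ((hF τ).differentiable (by norm_num) x)]
    congr 1
    ext k b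
    simp only [Matrix.of_apply]
    by_cases hk : k = i0
    · subst hk
      have e1 : (fun y => (F τ y) k) = fun y => f y * pd (τ k) g y := by
        ext y; simp [F, Fc]
      rw [e1, pd_mul (hf.differentiable (by norm_num) x)
        ((contDiff_pd hg _).differentiable (by norm_num) x)]
      rw [Function.update_self, ← hessMat_apply, ← transpose_apply (hessMat g x),
        hessMat_symm hg.contDiffAt]
      simp [vecMulVec_apply, gradv]
    · have e1 : (fun y => (F τ y) k) = pd (τ k) (H k) := by
        ext y; simp [F, Fc, hk]
      rw [e1, Function.update_of_ne hk, ← hessMat_apply, ← transpose_apply (hessMat (H k) x),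
        hessMat_symm (hH k).contDiffAt]
  simp_rw [hpt]
  rw [integral_const_mul, integral_finset_sum]
  · simp_rw [integral_const_mul, integral_det_fderiv_eq_zero n hn _ (hF _) (hFs _)]
    simp
  · intro τ _
    apply Integrable.const_mul
    apply Continuous.integrable_of_hasCompactSupport
    · exact ContinuousLinearMap.continuous_det.comp ((hF τ).continuous_fderiv one_ne_zero)
    · have : Nonempty (Fin n) := ⟨⟨0, hn⟩⟩
      refine ((hFs τ).fderiv (𝕜 := ℝ)).comp_left (g := fun L : Euc n →L[ℝ] Euc n => L.det) ?_
      have := ContinuousLinearMap.det (0 : Euc n →L[ℝ] Euc n)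
      simp only [ContinuousLinearMap.det, ContinuousLinearMap.toLinearMap_zero]
      rw [LinearMap.det_zero]
      simp; omega

lemma ibp_symm (n : ℕ) (hn : 1 ≤ n) (f g : Euc n → ℝ) (H : Fin n → Euc n → ℝ) (i0 : Fin n)
    (hf : ContDiff ℝ 2 f) (hg : ContDiff ℝ 2 g) (hH : ∀ k, ContDiff ℝ 2 (H k))
    (hfc : HasCompactSupport f) (hgc : HasCompactSupport g) (hHc : ∀ k, HasCompactSupport (H k)) :
    ∫ x, (f x * mdML n (Function.update (fun k => hessMat (H k) x) i0 (hessMat g x))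
      - g x * mdML n (Function.update (fun k => hessMat (H k) x) i0 (hessMat f x))) = 0 := by
  have h1 := ibp_aux n hn f g H i0 hf hg hH hfc hgc hHc
  have h2 := ibp_aux n hn g f H i0 hg hf hH hgc hfc hHc
  have hIntg : ∀ f g : Euc n → ℝ, ContDiff ℝ 2 f → ContDiff ℝ 2 g → HasCompactSupport f →
      HasCompactSupport g → 
      Integrable (fun x => mdML n (Function.update (fun k => hessMat (H k) x) i0
      (f x • hessMat g x + vecMulVec (gradv g x) (gradv f x)))) := by
    intro f g hf hg hfc hgc
    apply Continuous.integrable_of_hasCompactSupport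
    · refine (md_continuous n).comp ?_
      refine Continuous.update (continuous_pi fun k => hessMat_cont (hH k)) i0 ?_
      refine (hf.continuous.smul (hessMat_cont hg)).add ?_
      exact Continuous.matrix_vecMulVec (gradv_cont hg) (gradv_cont hf)
    · refine HasCompactSupport.intro hfc.isCompact fun x hx => ?_
      apply MultilinearMap.map_coord_zero _ i0
      rw [Function.update_self, image_eq_zero_of_notMem_tsupport hx]
      have : gradv f x = 0 := by
        have := notMem_tsupport_iff_eventuallyEq.mp hx
        rw [gradv_congr this]
        exact gradv_const 0 x
      simp [this]
  rw [← sub_eq_zero.mpr (h1.trans h2.symm), ← integral_sub (hIntg f g hf hg hfc hgc)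
    (hIntg g f hg hf hgc hfc)]
  congr 1
  ext x
  have ht : mdML n (Function.update (fun k => hessMat (H k) x) i0 (vecMulVec (gradv g x) (gradv f x)))
      = mdML n (Function.update (fun k => hessMat (H k) x) i0 (vecMulVec (gradv f x) (gradv g x))) := by
    rw [← md_transpose]
    congr 1
    ext1 k
    by_cases hk : k = i0
    · subst hk
      simp [transpose_vecMulVec]
    · simp [Function.update_of_ne hk, hessMat_symm (hH k).contDiffAt]
  rw [MultilinearMap.map_update_add, MultilinearMap.map_update_add, MultilinearMap.map_update_smul,
    MultilinearMap.map_update_smul, ht]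
  simp only [smul_eq_mul]
  ring

/-! ### Radial cutoffs -/

/-- inner bump -/
def bmp1 : ContDiffBump (10 : ℝ) := ⟨1, 2, by norm_num, by norm_num⟩
/-- outer bump -/
def bmp2 : ContDiffBump (10 : ℝ) := ⟨3, 4, by norm_num, by norm_num⟩

/-- radial cutoff -/
def cut1 {n : ℕ} (x : Euc n) : ℝ := bmp1 (‖x‖ ^ 2)
/-- radial cutoff -/
def cut2 {n : ℕ} (x : Euc n) : ℝ := bmp2 (‖x‖ ^ 2)

lemma bmp_cut_contDiff {n : ℕ} (b : ContDiffBump (10 : ℝ)) :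
    ContDiff ℝ 2 (fun x : Euc n => b (‖x‖ ^ 2)) :=
  b.contDiff.comp (contDiff_norm_sq ℝ)

lemma bmp_zero (b : ContDiffBump (10 : ℝ)) (hb : b.rOut ≤ 4) {t : ℝ} (ht : t < 6 ∨ 14 < t) :
    b t = 0 := by
  apply b.zero_of_le_dist
  rw [Real.dist_eq]
  rcases ht with ht | ht
  · rw [abs_of_neg (by linarith)]; linarith
  · rw [abs_of_pos (by linarith)]; linarith

lemma cut_contDiff {n : ℕ} (b : ContDiffBump (10 : ℝ)) (hb : b.rOut ≤ 4) {f : Euc n → ℝ}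
    (hf : ContDiffOn ℝ 2 f {(0 : Euc n)}ᶜ) : ContDiff ℝ 2 (fun x : Euc n => b (‖x‖ ^ 2) * f x) := by
  rw [contDiff_iff_contDiffAt]
  intro x
  by_cases hx : x = 0
  · have : (fun x : Euc n => b (‖x‖ ^ 2) * f x) =ᶠ[nhds x] fun _ => 0 := by
      have h : ∀ᶠ y : Euc n in nhds x, ‖y‖ ^ 2 < 6 := by
        have hcont : Continuous (fun y : Euc n => ‖y‖ ^ 2) := by fun_prop
        exact hcont.continuousAt.eventually (Iio_mem_nhds (by simp [hx]))
      filter_upwards [h] with y hy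
      rw [bmp_zero b hb (Or.inl hy), zero_mul]
    exact contDiffAt_const.congr_of_eventuallyEq this
  · exact (bmp_cut_contDiff b).contDiffAt.mul
      (hf.contDiffAt (isOpen_compl_singleton.mem_nhds hx))

lemma cut_compact {n : ℕ} (b : ContDiffBump (10 : ℝ)) (hb : b.rOut ≤ 4) (f : Euc n → ℝ) :
    HasCompactSupport (fun x : Euc n => b (‖x‖ ^ 2) * f x) := by
  refine HasCompactSupport.intro (isCompact_closedBall (0 : Euc n) 4) fun x hx => ?_
  rw [bmp_zero b hb, zero_mul]
  right
  simp at hx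
  nlinarith

lemma cut_ibp (n : ℕ) (f g : Euc n → ℝ) (H : Fin n → Euc n → ℝ) (i0 L : Fin n) (hiL : i0 ≠ L)
    (hf : ContDiffOn ℝ 2 f {(0 : Euc n)}ᶜ) (hg : ContDiffOn ℝ 2 g {(0 : Euc n)}ᶜ)
    (hf1 : Hom1 f) (hg1 : Hom1 g)
    (hH : ∀ k, k ≠ L → ContDiffOn ℝ 2 (H k) {(0 : Euc n)}ᶜ) (hH1 : ∀ k, k ≠ L → Hom1 (H k))
    (hL : H L = fun x => (1 / 2) * ‖x‖ ^ 2) :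
    ∫ x, cut1 x ^ 2 * (f x * mdML n (Function.update (fun k => hessMat (H k) x) i0 (hessMat g x))
      - g x * mdML n (Function.update (fun k => hessMat (H k) x) i0 (hessMat f x))) = 0 := by
  have hb1 : bmp1.rOut ≤ 4 := by norm_num [bmp1]
  have hb2 : bmp2.rOut ≤ 4 := by norm_num [bmp2]
  have hHL : ∀ k, ContDiffOn ℝ 2 (H k) {(0 : Euc n)}ᶜ := by
    intro k
    by_cases hk : k = L
    · subst hk
      rw [hL]
      exact (contDiff_const.mul (contDiff_norm_sq ℝ)).contDiffOn
    · exact hH k hk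
  have hn : 1 ≤ n := i0.pos
  have key := ibp_symm n hn (fun x => bmp1 (‖x‖ ^ 2) * f x) (fun x => bmp1 (‖x‖ ^ 2) * g x)
    (fun k x => bmp2 (‖x‖ ^ 2) * H k x) i0 (cut_contDiff _ hb1 hf) (cut_contDiff _ hb1 hg)
    (fun k => cut_contDiff _ hb2 (hHL k)) (cut_compact _ hb1 f) (cut_compact _ hb1 g)
    (fun k => cut_compact _ hb2 _)
  rw [← key]
  congr 1
  ext x
  by_cases hx : bmp1 (‖x‖ ^ 2) = 0
  · simp [cut1, hx]
  have hd : dist (‖x‖ ^ 2) 10 < 2 := by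
    by_contra hcon
    push Not at hcon
    exact hx (bmp1.zero_of_le_dist hcon)
  have hx0 : x ≠ 0 := by
    rintro rfl
    rw [Real.dist_eq] at hd
    norm_num at hd
  have hnb : ({(0 : Euc n)}ᶜ : Set (Euc n)) ∈ nhds x := isOpen_compl_singleton.mem_nhds hx0
  have hB : ∀ k, hessMat (fun x => bmp2 (‖x‖ ^ 2) * H k x) x = hessMat (H k) x := by
    intro k
    apply hessMat_congr
    have h : ∀ᶠ y : Euc n in nhds x, dist (‖y‖ ^ 2) 10 < 2 := by
      have hcont : Continuous (fun y : Euc n => dist (‖y‖ ^ 2) 10) := by fun_prop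
      exact hcont.continuousAt.eventually (Iio_mem_nhds hd)
    filter_upwards [h] with y hy
    rw [bmp2.one_of_mem_closedBall, one_mul]
    rw [mem_closedBall]
    refine hy.le.trans ?_
    norm_num [bmp2]
  simp only [hB]
  have hfx : ContDiffAt ℝ 2 f x := hf.contDiffAt hnb
  have hgx : ContDiffAt ℝ 2 g x := hg.contDiffAt hnb
  have hηx : ContDiffAt ℝ 2 (fun x : Euc n => bmp1 (‖x‖ ^ 2)) x := (bmp_cut_contDiff bmp1).contDiffAt
  rw [hessMat_mul hηx hfx, hessMat_mul hηx hgx]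
  set η := fun x : Euc n => bmp1 (‖x‖ ^ 2) with hη
  obtain ⟨c, hc⟩ : ∃ c : ℝ, gradv η x = c • x.ofLp :=
    gradv_normsq_comp ((bmp1.contDiff (n := 1)).differentiable (by norm_num)) x
  set B := fun k => hessMat (H k) x with hBdef
  have hBs : ∀ k, (B k)ᵀ = B k := fun k => hessMat_symm ((hHL k).contDiffAt hnb)
  have hxL : x.ofLp ≠ 0 := fun h => hx0 (by ext i; exact congrFun h i)
  -- the cross terms
  set w := f x • gradv g x - g x • gradv f x with hw
  have hwx : w ⬝ᵥ x.ofLp = 0 := by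
    rw [hw, sub_dotProduct, smul_dotProduct, smul_dotProduct,
      hom1_euler hf1 (hfx.differentiableAt (by norm_num)),
      hom1_euler hg1 (hgx.differentiableAt (by norm_num))]
    simp only [smul_eq_mul]; ring
  have hBx : ∀ k, B k *ᵥ x.ofLp = (if k = L then (1:ℝ) else 0) • x.ofLp := by
    intro k
    split_ifs with hk
    · subst hk
      simp only [hBdef, hL]
      rw [hessMat_const_mul _ (contDiff_norm_sq ℝ).contDiffAt, hessMat_normsq]
      simp
    · rw [zero_smul]
      exact hom1_hess_kill (hH1 k hk) ((hHL k).contDiffAt hnb)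
  have z1 : mdML n (Function.update B i0 (vecMulVec (gradv η x) w)) = 0 := by
    rw [hc]
    refine md_rankone _ i0 x.ofLp (c • w) hxL (by rw [smul_dotProduct, hwx, smul_zero]) ?_
      (fun k => if k = L then (1:ℝ) else 0) ?_
    · rw [Function.update_self, smul_vecMulVec, vecMulVec_smul]
    · intro k hk
      rw [Function.update_of_ne hk, hBx]
  have z2 : mdML n (Function.update B i0 (vecMulVec w (gradv η x))) = 0 := by
    rw [← md_transpose, ← z1]
    congr 1
    ext1 k
    by_cases hk : k = i0
    · subst hk
      simp [transpose_vecMulVec]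
    · simp only [Function.update_of_ne hk, hBs]
  rw [hw, sub_eq_add_neg, vecMulVec_add, ← neg_smul, vecMulVec_smul, vecMulVec_smul,
    MultilinearMap.map_update_add, MultilinearMap.map_update_smul, MultilinearMap.map_update_smul] at z1
  rw [hw, sub_eq_add_neg, add_vecMulVec, ← neg_smul, smul_vecMulVec, smul_vecMulVec,
    MultilinearMap.map_update_add, MultilinearMap.map_update_smul, MultilinearMap.map_update_smul] at z2
  simp only [MultilinearMap.map_update_add, MultilinearMap.map_update_smul, smul_eq_mul] at z1 z2 ⊢
  have hc1 : cut1 x = η x := rfl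
  rw [hc1]
  have hηd : bmp1 (‖x‖ ^ 2) = η x := rfl
  linear_combination (-η x) * z1 - (η x) * z2

/-! ### The measure on the sphere is finite -/

lemma sph_finite_aux (m : ℕ) :
    (μH[(m : ℝ)] : Measure (Euc (m + 1))) (sphere (0 : Euc (m + 1)) 1) < ⊤ := by
  let p : Fin (m + 1) → ℝ → (Fin m → ℝ) → Euc (m + 1) := fun i s y =>
    WithLp.toLp 2 (Fin.insertNth (α := fun _ => ℝ) i s y)
  let Ψ : Fin (m + 1) → ℝ → (Fin m → ℝ) → Euc (m + 1) := fun i s y => ‖p i s y‖⁻¹ • p i s y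
  have hp : ∀ i s, ContDiff ℝ 1 (p i s) := by
    intro i s
    refine contDiff_euclidean.mpr fun k => ?_
    simp only [p]
    rcases Fin.eq_self_or_eq_succAbove i k with h | ⟨l, h⟩
    · subst h
      simp only [Fin.insertNth_apply_same]
      exact contDiff_const
    · subst h
      simp only [Fin.insertNth_apply_succAbove]
      exact contDiff_apply ℝ ℝ l
  have hp0 : ∀ i s, s ≠ 0 → ∀ y, p i s y ≠ 0 := by
    intro i s hs y h
    have := congrArg (fun v : Euc (m + 1) => v i) h
    simp [p] at this
    exact hs this
  have hΨ : ∀ i s, s ≠ 0 → ContDiff ℝ 1 (Ψ i s) := by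
    intro i s hs
    refine ContDiff.smul (ContDiff.inv ?_ fun y => norm_ne_zero_iff.mpr (hp0 i s hs y)) (hp i s)
    exact (hp i s).norm ℝ (hp0 i s hs)
  have hfin : ∀ i s, s ≠ 0 → (μH[(m : ℝ)] : Measure (Euc (m + 1)))
      (Ψ i s '' Set.Icc (fun _ => -1) (fun _ => 1)) < ⊤ := by
    intro i s hs
    have hl : LocallyLipschitzOn (Set.Icc (fun _ => -1) (fun _ => 1)) (Ψ i s) :=
      ((hΨ i s hs).locallyLipschitz).locallyLipschitzOn
    obtain ⟨C, hC⟩ := hl.exists_lipschitzOnWith_of_compact isCompact_Icc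
    refine (hC.hausdorffMeasure_image_le (Nat.cast_nonneg m)).trans_lt ?_
    apply ENNReal.mul_lt_top
    · exact ENNReal.rpow_lt_top_of_nonneg (Nat.cast_nonneg m) ENNReal.coe_ne_top
    · have := hausdorffMeasure_pi_real (ι := Fin m)
      rw [Fintype.card_fin] at this
      rw [this]
      exact isCompact_Icc.measure_lt_top
  have hcov : sphere (0 : Euc (m + 1)) 1 ⊆ ⋃ i, (Ψ i 1 '' Set.Icc (fun _ => -1) (fun _ => 1)) ∪
      (Ψ i (-1) '' Set.Icc (fun _ => -1) (fun _ => 1)) := by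
    intro x hx
    have hx1 : ‖x‖ = 1 := by simpa using hx
    obtain ⟨i, -, hi⟩ := Finset.exists_max_image Finset.univ (fun k => |x k|)
      ⟨(0 : Fin (m + 1)), Finset.mem_univ _⟩
    have hM : 0 < |x i| := by
      rcases (abs_nonneg (x i)).lt_or_eq with h | h
      · exact h
      · exfalso
        have : x = 0 := by
          ext k
          have := hi k (Finset.mem_univ k)
          rw [← h] at this
          simpa using this
        rw [this] at hx1
        simp at hx1
    set M := |x i| with hMd
    have hmem : (fun l => M⁻¹ * x (i.succAbove l)) ∈ Set.Icc (fun _ : Fin m => (-1:ℝ)) (fun _ => 1) := by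
      have hb : ∀ l, |M⁻¹ * x (i.succAbove l)| ≤ 1 := by
        intro l
        rw [abs_mul, abs_of_pos (inv_pos.mpr hM), inv_mul_le_iff₀ hM, mul_one]
        exact hi _ (Finset.mem_univ _)
      exact ⟨fun l => (abs_le.mp (hb l)).1, fun l => (abs_le.mp (hb l)).2⟩
    have hrec : ∀ s, s = M⁻¹ * x i → Ψ i s (fun l => M⁻¹ * x (i.succAbove l)) = x := by
      intro s hs
      have : p i s (fun l => M⁻¹ * x (i.succAbove l)) = M⁻¹ • x := by
        ext k
        rcases Fin.eq_self_or_eq_succAbove i k with h | ⟨l, h⟩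
        · subst h; simp [p, hs]
        · subst h; simp [p]
      simp only [Ψ, this, norm_smul, hx1, Real.norm_of_nonneg (inv_pos.mpr hM).le, mul_one, inv_inv,
        smul_smul, mul_inv_cancel₀ hM.ne', one_smul]
    rw [Set.mem_iUnion]
    refine ⟨i, ?_⟩
    rcases le_total 0 (x i) with h | h
    · left
      refine ⟨_, hmem, hrec 1 ?_⟩
      have hxi : M = x i := abs_of_nonneg h
      rw [← hxi, inv_mul_cancel₀ hM.ne']
    · right
      refine ⟨_, hmem, hrec (-1) ?_⟩
      have hxi : M = -x i := abs_of_nonpos h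
      rw [show x i = -M by rw [hxi, neg_neg], mul_neg, inv_mul_cancel₀ hM.ne']
  refine (measure_mono hcov).trans_lt ?_
  refine (measure_iUnion_fintype_le _ _).trans_lt ?_
  refine ENNReal.sum_lt_top.mpr fun i _ => ?_
  exact (measure_union_le _ _).trans_lt (ENNReal.add_lt_top.mpr
    ⟨hfin i 1 (by norm_num), hfin i (-1) (by norm_num)⟩)

lemma sphM_finite (n : ℕ) (hn : 1 ≤ n) : IsFiniteMeasure (sphM n) := by
  obtain ⟨m, rfl⟩ : ∃ m, n = m + 1 := ⟨n - 1, by omega⟩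
  constructor
  rw [sphM, Measure.restrict_apply_univ]
  have : ((m + 1 : ℕ) : ℝ) - 1 = m := by push_cast; ring
  rw [this]
  exact sph_finite_aux m

/-! ### Uniqueness of the invariant measure -/

lemma exists_isom {n : ℕ} {u v : Euc n} (h : ‖u‖ = ‖v‖) : ∃ e : Euc n ≃ₗᵢ[ℝ] Euc n, e u = v :=
  ⟨_, Submodule.reflection_sub h⟩

lemma ball_const {n : ℕ} {μ : Measure (Euc n)} (hμ : ∀ e : Euc n ≃ₗᵢ[ℝ] Euc n, μ.map e = μ)
    {u v : Euc n} (h : ‖u‖ = ‖v‖) (δ : ℝ) : μ (ball u δ) = μ (ball v δ) := by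
  obtain ⟨e, he⟩ := exists_isom h
  conv_rhs => rw [← hμ e]
  rw [Measure.map_apply e.continuous.measurable measurableSet_ball, ← he]
  congr 1
  ext x
  simp

lemma inv_unique_cont {n : ℕ} (μ ν : Measure (Euc n)) [IsFiniteMeasure μ] [IsFiniteMeasure ν]
    (hμS : ∀ᵐ x ∂μ, ‖x‖ = 1) (hνS : ∀ᵐ x ∂ν, ‖x‖ = 1)
    (hμ : ∀ e : Euc n ≃ₗᵢ[ℝ] Euc n, μ.map e = μ) (hν : ∀ e : Euc n ≃ₗᵢ[ℝ] Euc n, ν.map e = ν)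
    (hν0 : ν ≠ 0) (G : Euc n → ℝ) (hG : Continuous G) (h : ∫ x, G x ∂ν = 0) : ∫ x, G x ∂μ = 0 := by
  have hScpt : IsCompact (sphere (0 : Euc n) 1) := isCompact_sphere 0 1
  obtain ⟨C, hC⟩ := hScpt.exists_bound_of_continuousOn hG.continuousOn
  have hCx : ∀ x : Euc n, ‖x‖ = 1 → ‖G x‖ ≤ C := fun x hx => hC x (by simpa using hx)
  -- a point on the sphere
  obtain ⟨u0, hu0⟩ : ∃ u0 : Euc n, ‖u0‖ = 1 := by
    by_contra hcon
    push Not at hcon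
    apply hν0
    have : ∀ᵐ x ∂ν, False := hνS.mono fun x hx => hcon x hx
    rwa [Filter.eventually_false_iff_eq_bot, ae_eq_bot] at this
  have hprod : ∀ᵐ p ∂(μ.prod ν), ‖p.1‖ = 1 ∧ ‖p.2‖ = 1 := by
    have h1 := Measure.quasiMeasurePreserving_fst (μ := μ) (ν := ν) |>.ae hμS
    have h2 := Measure.quasiMeasurePreserving_snd (μ := μ) (ν := ν) |>.ae hνS
    filter_upwards [h1, h2] with p hp1 hp2 using ⟨hp1, hp2⟩
  have hsmall : ∀ ε > 0, |∫ x, G x ∂μ| ≤ ε * μ.real Set.univ := by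
    intro ε hε
    have huc := hScpt.uniformContinuousOn_of_continuous hG.continuousOn
    obtain ⟨δ, hδ, hGδ⟩ := Metric.uniformContinuousOn_iff.mp huc ε hε
    set a := μ.real (ball u0 δ) with ha
    set b := ν.real (ball u0 δ) with hb
    have hbpos : 0 < b := by
      rw [hb, measureReal_def, ENNReal.toReal_pos_iff]
      refine ⟨?_, measure_lt_top _ _⟩
      rw [pos_iff_ne_zero]
      intro h0
      apply hν0
      obtain ⟨t, ht, htc⟩ := hScpt.elim_finite_subcover_image (b := sphere (0 : Euc n) 1)
        (c := fun u => ball u δ) (fun _ _ => isOpen_ball)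
        (fun x hx => Set.mem_biUnion hx (mem_ball_self hδ))
      obtain ⟨htf, htc⟩ := htc
      have hS0 : ν (sphere (0 : Euc n) 1) = 0 := by
        refine measure_mono_null htc ?_
        rw [measure_biUnion_null_iff htf.countable]
        intro u hu
        have hu1 : ‖u‖ = 1 := by simpa using ht hu
        rw [← h0]
        exact ball_const hν (hu1.trans hu0.symm) δ
      rw [← Measure.measure_univ_eq_zero]
      have : (Set.univ : Set (Euc n)) ⊆ sphere 0 1 ∪ {x | ¬ ‖x‖ = 1} := by
        intro x _
        by_cases hx : ‖x‖ = 1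
        · left; simpa using hx
        · right; exact hx
      exact measure_mono_null this (measure_union_null hS0 hνS)
    set D : Set (Euc n × Euc n) := {p | dist p.1 p.2 < δ} with hD
    have hDo : MeasurableSet D :=
      (isOpen_lt (by fun_prop) continuous_const).measurableSet
    have hi1 : Integrable (fun p : Euc n × Euc n => D.indicator (fun p => G p.1) p) (μ.prod ν) := by
      refine Integrable.indicator ?_ hDo
      refine Integrable.of_bound (C := C) (by fun_prop) ?_
      filter_upwards [hprod] with p hp using hCx _ hp.1
    have hi2 : Integrable (fun p : Euc n × Euc n => D.indicator (fun p => G p.2) p) (μ.prod ν) := by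
      refine Integrable.indicator ?_ hDo
      refine Integrable.of_bound (C := C) (by fun_prop) ?_
      filter_upwards [hprod] with p hp using hCx _ hp.2
    have hi3 : Integrable (fun p : Euc n × Euc n => D.indicator (fun _ => ε) p) (μ.prod ν) :=
      (integrable_const ε).indicator hDo
    have e1 : ∀ c : Euc n → ℝ, ∀ u : Euc n, ‖u‖ = 1 →
        ∫ v, D.indicator (fun p => c p.1) (u, v) ∂ν = c u * b := by
      intro c u hu
      have : (fun v => D.indicator (fun p => c p.1) (u, v)) = (ball u δ).indicator fun _ => c u := by
        ext v
        by_cases hd : dist u v < δ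
        · rw [Set.indicator_of_mem (show (u, v) ∈ D from hd), Set.indicator_of_mem (mem_ball'.mpr hd)]
        · rw [Set.indicator_of_notMem (show (u, v) ∉ D from hd),
            Set.indicator_of_notMem (fun h => hd (mem_ball'.mp h))]
      rw [this, integral_indicator measurableSet_ball, setIntegral_const, smul_eq_mul, mul_comm, hb,
        measureReal_def, measureReal_def, ball_const hν (hu.trans hu0.symm)]
    have e2 : ∀ v : Euc n, ‖v‖ = 1 →
        ∫ u, D.indicator (fun p => G p.2) (u, v) ∂μ = G v * a := by
      intro v hv
      have : (fun u => D.indicator (fun p => G p.2) (u, v)) = (ball v δ).indicator fun _ => G v := by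
        ext u
        by_cases hd : dist u v < δ
        · rw [Set.indicator_of_mem (show (u, v) ∈ D from hd), Set.indicator_of_mem (mem_ball.mpr hd)]
        · rw [Set.indicator_of_notMem (show (u, v) ∉ D from hd),
            Set.indicator_of_notMem (fun h => hd (mem_ball.mp h))]
      rw [this, integral_indicator measurableSet_ball, setIntegral_const, smul_eq_mul, mul_comm, ha,
        measureReal_def, measureReal_def, ball_const hμ (hv.trans hu0.symm)]
    have I1 : ∫ p, D.indicator (fun p => G p.1) p ∂(μ.prod ν) = (∫ x, G x ∂μ) * b := by
      rw [integral_prod _ hi1, ← integral_mul_const]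
      apply integral_congr_ae
      filter_upwards [hμS] with u hu using e1 G u hu
    have I2 : ∫ p, D.indicator (fun p => G p.2) p ∂(μ.prod ν) = 0 := by
      rw [integral_prod_symm _ hi2]
      have : ∫ v, (∫ u, D.indicator (fun p => G p.2) (u, v) ∂μ) ∂ν = ∫ v, G v * a ∂ν := by
        apply integral_congr_ae
        filter_upwards [hνS] with v hv using e2 v hv
      rw [this, integral_mul_const, h, zero_mul]
    have I3 : ∫ p, D.indicator (fun _ => ε) p ∂(μ.prod ν) = ε * b * μ.real Set.univ := by
      rw [integral_prod _ hi3]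
      have : ∫ u, (∫ v, D.indicator (fun _ => ε) (u, v) ∂ν) ∂μ = ∫ _u, ε * b ∂μ := by
        apply integral_congr_ae
        filter_upwards [hμS] with u hu using e1 (fun _ => ε) u hu
      rw [this, integral_const, smul_eq_mul, mul_comm]
    have hle : |(∫ x, G x ∂μ) * b| ≤ ε * b * μ.real Set.univ := by
      rw [← sub_zero ((∫ x, G x ∂μ) * b), ← I1, ← I2, ← I3, ← integral_sub hi1 hi2]
      rw [← Real.norm_eq_abs]
      refine norm_integral_le_of_norm_le hi3 ?_
      filter_upwards [hprod] with p hp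
      by_cases hpD : p ∈ D
      · simp only [Set.indicator_of_mem hpD]
        have := hGδ p.1 (by simpa using hp.1) p.2 (by simpa using hp.2) hpD
        exact this.le
      · simp [Set.indicator_of_notMem hpD]
    rw [abs_mul, abs_of_pos hbpos] at hle
    have : |∫ x, G x ∂μ| * b ≤ (ε * μ.real Set.univ) * b := by linarith
    exact le_of_mul_le_mul_right this hbpos
  have : |∫ x, G x ∂μ| ≤ 0 := by
    apply le_of_forall_pos_le_add
    intro η hη
    have hM : 0 ≤ μ.real Set.univ := measureReal_nonneg
    have := hsmall (η / (μ.real Set.univ + 1)) (by positivity)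
    refine this.trans ?_
    rw [zero_add, div_mul_eq_mul_div, div_le_iff₀ (by positivity)]
    nlinarith
  exact abs_eq_zero.mp (le_antisymm this (abs_nonneg _))

lemma sphM_inv (n : ℕ) (e : Euc n ≃ₗᵢ[ℝ] Euc n) : (sphM n).map e = sphM n := by
  have h := (IsometryEquiv.measurePreserving_hausdorffMeasure e.toIsometryEquiv ((n : ℝ) - 1))
  have h2 := h.restrict_preimage (s := sphere (0 : Euc n) 1) isClosed_sphere.measurableSet
  have h3 : e.toIsometryEquiv ⁻¹' (sphere (0 : Euc n) 1) = sphere 0 1 := by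
    ext x; simp
  rw [h3] at h2
  exact h2.map_eq

lemma sphM_ae (n : ℕ) : ∀ᵐ x ∂(sphM n), ‖x‖ = 1 := by
  have := ae_restrict_mem (μ := (μH[(n : ℝ) - 1] : Measure (Euc n)))
    (isClosed_sphere (x := (0 : Euc n)) (ε := 1)).measurableSet
  filter_upwards [this] with x hx
  simpa using hx

lemma sph_integral_zero (n : ℕ) (hn : 1 ≤ n) (G : Euc n → ℝ)
    (hG : ContinuousOn G (sphere (0 : Euc n) 1)) (ρ : Euc n → ℝ) (hρ : Continuous ρ)
    (hρ0 : ∀ x, 0 ≤ ρ x) (hρc : HasCompactSupport ρ)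
    (hρe : ∀ (e : Euc n ≃ₗᵢ[ℝ] Euc n) x, ρ (e x) = ρ x) (x1 : Euc n) (hx1 : 0 < ρ x1)
    (h : ∫ x, ρ x * G (‖x‖⁻¹ • x) = 0) : ∫ x, G x ∂(sphM n) = 0 := by
  have := sphM_finite n hn
  have : Nonempty (Fin n) := ⟨⟨0, hn⟩⟩
  obtain ⟨G', hG'⟩ := ContinuousMap.exists_restrict_eq (isClosed_sphere (x := (0 : Euc n)) (ε := 1))
    ⟨_, continuousOn_iff_continuous_domRestrict.mp hG⟩
  have hGG : ∀ x : Euc n, ‖x‖ = 1 → G x = G' x := by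
    intro x hx
    have := congrArg (fun F => F ⟨x, by simpa using hx⟩) hG'
    exact this.symm
  have hae : ∀ᵐ x : Euc n, x ≠ 0 := by
    rw [ae_iff]
    simp
  have hnrm : ∀ x : Euc n, x ≠ 0 → ‖‖x‖⁻¹ • x‖ = 1 := by
    intro x hx
    rw [norm_smul, norm_inv, norm_norm, inv_mul_cancel₀ (norm_ne_zero_iff.mpr hx)]
  set d : Euc n → ENNReal := fun x => ENNReal.ofReal (ρ x) with hd
  have hdm : Measurable d := hρ.measurable.ennreal_ofReal
  set m : Measure (Euc n) := volume.withDensity d with hm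
  have hρi : Integrable ρ := hρ.integrable_of_hasCompactSupport hρc
  have hmf : IsFiniteMeasure m := isFiniteMeasure_withDensity_ofReal hρi.2
  set π : Euc n → Euc n := fun x => ‖x‖⁻¹ • x with hπ
  have hπm : Measurable π := by fun_prop
  set ν := m.map π with hν
  have hνf : IsFiniteMeasure ν := by
    rw [hν]; infer_instance
  have hminv : ∀ e : Euc n ≃ₗᵢ[ℝ] Euc n, m.map e = m := by
    intro e
    ext s hs
    rw [Measure.map_apply e.continuous.measurable hs, hm, withDensity_apply _ hs,
      withDensity_apply _ (e.continuous.measurable hs)]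
    rw [← (e.measurePreserving).setLIntegral_comp_preimage hs hdm]
    simp only [hd, hρe]
  have hνinv : ∀ e : Euc n ≃ₗᵢ[ℝ] Euc n, ν.map e = ν := by
    intro e
    rw [hν, Measure.map_map e.continuous.measurable hπm]
    have : e ∘ π = π ∘ e := by
      ext1 x
      simp [π]
    rw [this, ← Measure.map_map hπm e.continuous.measurable, hminv]
  have hmae : ∀ᵐ x ∂m, x ≠ 0 := (withDensity_absolutelyContinuous _ _).ae_le hae
  have hνS : ∀ᵐ x ∂ν, ‖x‖ = 1 := by
    rw [hν, ae_map_iff hπm.aemeasurable (measurableSet_eq_fun measurable_norm measurable_const)]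
    filter_upwards [hmae] with x hx using hnrm x hx
  have hν0 : ν ≠ 0 := by
    rw [hν, Ne, Measure.map_eq_zero_iff hπm.aemeasurable]
    intro h0
    have h1 : m Set.univ = 0 := by rw [h0]; rfl
    rw [hm, withDensity_apply _ MeasurableSet.univ, Measure.restrict_univ,
      lintegral_eq_zero_iff hdm] at h1
    have h2 : d = 0 := by
      have hdc : Continuous d := ENNReal.continuous_ofReal.comp hρ
      exact (hdc.ae_eq_iff_eq volume continuous_const).mp h1
    have h3 := congrFun h2 x1
    simp only [hd, Pi.zero_apply, ENNReal.ofReal_eq_zero] at h3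
    linarith
  have hIntg : ∫ x, G' x ∂ν = 0 := by
    rw [hν, integral_map hπm.aemeasurable G'.continuous.aestronglyMeasurable, hm,
      integral_withDensity_eq_integral_toReal_smul hdm (by simp [hd]), ← h]
    apply integral_congr_ae
    filter_upwards [hae] with x hx
    simp only [hd, ENNReal.toReal_ofReal (hρ0 x), smul_eq_mul]
    rw [hGG _ (hnrm x hx)]
  rw [← inv_unique_cont (sphM n) ν (sphM_ae n) hνS (sphM_inv n) hνinv hν0 G' G'.continuous hIntg]
  apply integral_congr_ae
  filter_upwards [sphM_ae n] with x hx using hGG x hx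

/-- symmetry on the sphere -/
lemma sph_symm (n : ℕ) (f g : Euc n → ℝ) (H : Fin n → Euc n → ℝ) (i0 L : Fin n) (hiL : i0 ≠ L)
    (hf : ContDiffOn ℝ 2 f {(0 : Euc n)}ᶜ) (hg : ContDiffOn ℝ 2 g {(0 : Euc n)}ᶜ)
    (hf1 : Hom1 f) (hg1 : Hom1 g)
    (hH : ∀ k, k ≠ L → ContDiffOn ℝ 2 (H k) {(0 : Euc n)}ᶜ) (hH1 : ∀ k, k ≠ L → Hom1 (H k))
    (hL : H L = fun x => (1 / 2) * ‖x‖ ^ 2) :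
    ∫ x, (f x * mdML n (Function.update (fun k => hessMat (H k) x) i0 (hessMat g x))
      - g x * mdML n (Function.update (fun k => hessMat (H k) x) i0 (hessMat f x))) ∂(sphM n) = 0 := by
  have hn : 1 ≤ n := i0.pos
  have hb1 : bmp1.rOut ≤ 4 := by norm_num [bmp1]
  have hHL : ∀ k, ContDiffOn ℝ 2 (H k) {(0 : Euc n)}ᶜ := by
    intro k
    by_cases hk : k = L
    · subst hk
      rw [hL]
      exact (contDiff_const.mul (contDiff_norm_sq ℝ)).contDiffOn
    · exact hH k hk
  have hcon : ∀ g : Euc n → ℝ, ContDiffOn ℝ 2 g {(0 : Euc n)}ᶜ → ContinuousOn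
      (fun x => mdML n (Function.update (fun k => hessMat (H k) x) i0 (hessMat g x))) {(0 : Euc n)}ᶜ := by
    intro g hg
    refine (md_continuous n).comp_continuousOn ?_
    refine continuousOn_pi.mpr fun k => ?_
    by_cases hk : k = i0
    · subst hk
      simp only [Function.update_self]
      exact hessMat_continuousOn isOpen_compl_singleton hg
    · simp only [Function.update_of_ne hk]
      exact hessMat_continuousOn isOpen_compl_singleton (hHL k)
  have hsub : sphere (0 : Euc n) 1 ⊆ {(0 : Euc n)}ᶜ := by
    intro x hx h0
    rw [Set.mem_singleton_iff] at h0
    simp [h0] at hx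
  set q : Euc n → ℝ := fun x => bmp1 (‖x‖ ^ 2) * (‖x‖ * (‖x‖⁻¹) ^ (n - 1)) with hq
  have hnC : ContDiffOn ℝ 2 (fun x : Euc n => ‖x‖) {(0 : Euc n)}ᶜ := fun x hx =>
    (contDiffAt_norm ℝ hx).contDiffWithinAt
  have hqC : ContDiffOn ℝ 2 q {(0 : Euc n)}ᶜ := by
    refine (bmp_cut_contDiff bmp1).contDiffOn.mul (hnC.mul (ContDiffOn.pow (hnC.inv ?_) _))
    intro x hx
    exact norm_ne_zero_iff.mpr hx
  let i : Fin n := i0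
  refine sph_integral_zero n hn _ ?_ (fun x => bmp1 (‖x‖ ^ 2) * q x)
    (cut_contDiff bmp1 hb1 hqC).continuous ?_ (cut_compact bmp1 hb1 q) ?_
    (Real.sqrt 10 • EuclideanSpace.single i0 1) ?_ ?_
  · exact ((hf.continuousOn.mul (hcon g hg)).sub (hg.continuousOn.mul (hcon f hf))).mono hsub
  · intro x
    have := bmp1.nonneg (x := ‖x‖ ^ 2)
    simp only [hq]
    positivity
  · intro e x
    simp [hq]
  · have hnn : ‖Real.sqrt 10 • (EuclideanSpace.single i0 1 : Euc n)‖ = Real.sqrt 10 := by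
      rw [norm_smul, Real.norm_of_nonneg (Real.sqrt_nonneg _)]
      simp
    have h1 : bmp1 (Real.sqrt 10 ^ 2) = 1 := by
      rw [Real.sq_sqrt (by norm_num)]
      apply bmp1.one_of_mem_closedBall
      simp [bmp1]
    simp only [hq, hnn, h1]
    have : 0 < Real.sqrt 10 := Real.sqrt_pos.mpr (by norm_num)
    positivity
  · rw [← cut_ibp n f g H i0 L hiL hf hg hf1 hg1 hH hH1 hL]
    apply integral_congr_ae
    have : Nonempty (Fin n) := ⟨i0⟩
    have hae : ∀ᵐ x : Euc n, x ≠ 0 := by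
      rw [ae_iff]
      simp
    filter_upwards [hae] with x hx
    set r := ‖x‖ with hr
    have hr0 : 0 < r := norm_pos_iff.mpr hx
    set y := r⁻¹ • x with hy
    have hxy : x = r • y := by rw [hy, smul_smul, mul_inv_cancel₀ hr0.ne', one_smul]
    have hsc : ∀ g : Euc n → ℝ, Hom1 g →
        mdML n (Function.update (fun k => hessMat (H k) x) i0 (hessMat g x))
        = (r⁻¹) ^ (n - 1) * mdML n (Function.update (fun k => hessMat (H k) y) i0 (hessMat g y)) := by
      intro g hg1
      have e : Function.update (fun k => hessMat (H k) x) i0 (hessMat g x)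
          = fun k => (if k = L then (1:ℝ) else r⁻¹) •
            (Function.update (fun k => hessMat (H k) y) i0 (hessMat g y)) k := by
        ext1 k
        by_cases hk : k = i0
        · subst hk
          rw [Function.update_self, Function.update_self, if_neg hiL, hxy, hom1_hess_scale hg1 hr0]
        · rw [Function.update_of_ne hk, Function.update_of_ne hk]
          by_cases hkL : k = L
          · subst hkL
            rw [if_pos rfl, one_smul, hL, hessMat_const_mul _ (contDiff_norm_sq ℝ).contDiffAt,
              hessMat_const_mul _ (contDiff_norm_sq ℝ).contDiffAt, hessMat_normsq, hessMat_normsq]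
          · rw [if_neg hkL, hxy, hom1_hess_scale (hH1 k hkL) hr0]
      rw [e, MultilinearMap.map_smul_univ, smul_eq_mul]
      congr 1
      rw [Finset.prod_ite, Finset.prod_const_one, one_mul, Finset.prod_const]
      congr 1
      rw [Finset.filter_ne', Finset.card_erase_of_mem (Finset.mem_univ _)]
      simp
    rw [hsc f hf1, hsc g hg1]
    have hfx : f x = r * f y := by rw [hxy, hf1 r hr0]
    have hgx : g x = r * g y := by rw [hxy, hg1 r hr0]
    rw [hfx, hgx]
    simp only [hq, cut1, ← hr]
    ring

/-! ### The support function -/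

lemma suppFn_hom1 {n : ℕ} (K : Set (Euc n)) : Hom1 (suppFn K) := by
  intro c hc x
  have : (fun y => ⟪c • x, y⟫) '' K = c • ((fun y => ⟪x, y⟫) '' K) := by
    ext t
    simp only [Set.mem_image, Set.mem_smul_set, exists_exists_and_eq_and, real_inner_smul_left,
      smul_eq_mul]
  rw [suppFn, this, Real.sSup_smul_of_nonneg hc.le, smul_eq_mul, suppFn]

lemma suppFn_pos {n : ℕ} (K : Set (Euc n)) (hKcp : IsCompact K)
    (hKint : (interior K).Nonempty) (hKs : ∀ x ∈ K, -x ∈ K) {x : Euc n} (hx : x ≠ 0) :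
    0 < suppFn K x := by
  obtain ⟨x0, hx0⟩ := hKint
  obtain ⟨r, hr, hball⟩ := Metric.isOpen_iff.mp isOpen_interior x0 hx0
  have hxn : 0 < ‖x‖ := norm_pos_iff.mpr hx
  set t := r / (2 * ‖x‖) with ht
  have htp : 0 < t := by positivity
  have htx : t * ‖x‖ < r := by
    rw [ht]; field_simp; linarith
  have m1 : x0 + t • x ∈ K := by
    apply interior_subset
    apply hball
    rw [mem_ball, dist_eq_norm, add_sub_cancel_left, norm_smul, Real.norm_of_nonneg htp.le]
    exact htx
  have m2 : x0 - t • x ∈ K := by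
    apply interior_subset
    apply hball
    rw [mem_ball, dist_eq_norm, sub_sub_cancel_left, norm_neg, norm_smul, Real.norm_of_nonneg htp.le]
    exact htx
  have hbdd : BddAbove ((fun y => ⟪x, y⟫) '' K) :=
    (hKcp.image (by fun_prop)).bddAbove
  have l1 : ⟪x, x0 + t • x⟫ ≤ suppFn K x := le_csSup hbdd ⟨_, m1, rfl⟩
  have l2 : ⟪x, -(x0 - t • x)⟫ ≤ suppFn K x := le_csSup hbdd ⟨_, hKs _ m2, rfl⟩
  rw [inner_add_right, real_inner_smul_right, real_inner_self_eq_norm_sq] at l1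
  rw [inner_neg_right, inner_sub_right, real_inner_smul_right, real_inner_self_eq_norm_sq] at l2
  have : 0 < t * ‖x‖ ^ 2 := by positivity
  linarith

/-! ### Assembly -/

/-- the family of functions `(h[j-1], |x|[n-j], |x|^2/2)` -/
def Hfam (n j : ℕ) (h : Euc n → ℝ) (k : Fin n) : Euc n → ℝ :=
  if (k : ℕ) < n - 1 then (if (k : ℕ) < j - 1 then h else fun x => ‖x‖)
  else fun x => (1 / 2) * ‖x‖ ^ 2

/-- the mixed functional -/
def Qf (n j : ℕ) (h : Euc n → ℝ) (i0 : Fin n) (f : Euc n → ℝ) (u : Euc n) : ℝ :=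
  mdML n (Function.update (fun k => hessMat (Hfam n j h k) u) i0 (hessMat f u))

lemma norm_C2 (n : ℕ) : ContDiffOn ℝ 2 (fun x : Euc n => ‖x‖) {(0 : Euc n)}ᶜ := fun _ hx =>
  (contDiffAt_norm ℝ hx).contDiffWithinAt

lemma C2at {n : ℕ} {f : Euc n → ℝ} (hf : ContDiffOn ℝ 2 f {(0 : Euc n)}ᶜ) {u : Euc n}
    (hu : ‖u‖ = 1) : ContDiffAt ℝ 2 f u := by
  apply hf.contDiffAt (isOpen_compl_singleton.mem_nhds _)
  rintro rfl
  simp at hu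

lemma Hfam_C2 {n j : ℕ} {h : Euc n → ℝ} (hC : ContDiffOn ℝ 2 h {(0 : Euc n)}ᶜ) (k : Fin n) :
    ContDiffOn ℝ 2 (Hfam n j h k) {(0 : Euc n)}ᶜ := by
  unfold Hfam
  split_ifs
  · exact hC
  · exact norm_C2 n
  · exact (contDiff_const.mul (contDiff_norm_sq ℝ)).contDiffOn

lemma Hfam_hom {n j : ℕ} {h : Euc n → ℝ} (h1 : Hom1 h) (k : Fin n) (hk : (k : ℕ) < n - 1) :
    Hom1 (Hfam n j h k) := by
  unfold Hfam
  rw [if_pos hk]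
  split_ifs
  · exact h1
  · exact norm_hom1

lemma Hfam_quad {n j : ℕ} {h : Euc n → ℝ}
    (hKpd : ∀ u : Euc n, ‖u‖ = 1 → ∀ w : Euc n, w ≠ 0 → ⟪w, u⟫ = 0 →
      0 < ((EuclideanSpace.equiv (Fin n) ℝ) w) ⬝ᵥ
        ((hessMat h u).mulVec ((EuclideanSpace.equiv (Fin n) ℝ) w)))
    {u : Euc n} (hu : ‖u‖ = 1) (k : Fin n) (hk : (k : ℕ) < n - 1) (w : Fin n → ℝ) (hw : w ≠ 0)
    (hwu : w ⬝ᵥ u.ofLp = 0) : 0 < w ⬝ᵥ (hessMat (Hfam n j h k) u *ᵥ w) := by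
  unfold Hfam
  rw [if_pos hk]
  split_ifs
  · refine hKpd u hu (WithLp.toLp 2 w) ?_ ?_
    · intro h0
      apply hw
      ext i
      exact congrArg (fun v : Euc n => v i) h0
    · rw [EuclideanSpace.inner_eq_star_dotProduct]
      simpa [dotProduct_comm] using hwu
  · rw [norm_hess_quad hu w hwu]
    have h0 : 0 ≤ w ⬝ᵥ w := dotProduct_self_star_nonneg w
    exact lt_of_le_of_ne h0 fun h => hw (dotProduct_self_eq_zero.mp h.symm)

lemma unit_dot {n : ℕ} {u : Euc n} (hu : ‖u‖ = 1) : u.ofLp ⬝ᵥ u.ofLp = 1 := by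
  have := EuclideanSpace.real_norm_sq_eq u
  rw [hu] at this
  simp only [dotProduct, ← sq]
  rw [← this]; norm_num

lemma psd_of_kill {n : ℕ} {M : Matrix (Fin n) (Fin n) ℝ} (hM : Mᵀ = M) {v : Fin n → ℝ}
    (hv : v ⬝ᵥ v = 1) (hk : M *ᵥ v = 0)
    (hq : ∀ w, w ≠ 0 → w ⬝ᵥ v = 0 → 0 < w ⬝ᵥ (M *ᵥ w)) : M.PosSemidef := by
  refine PosSemidef.of_dotProduct_mulVec_nonneg (by simpa [IsHermitian] using hM) fun x => ?_
  simp only [star_trivial]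
  set c := x ⬝ᵥ v with hc
  set w := x - c • v with hw
  have hx : x = w + c • v := by simp [hw]
  have hwv : w ⬝ᵥ v = 0 := by
    rw [hw, sub_dotProduct, smul_dotProduct, hv, smul_eq_mul, mul_one, sub_self]
  have hvM : ∀ y, v ⬝ᵥ (M *ᵥ y) = 0 := by
    intro y
    rw [dotProduct_mulVec, ← mulVec_transpose, hM, hk, zero_dotProduct]
  have : x ⬝ᵥ (M *ᵥ x) = w ⬝ᵥ (M *ᵥ w) := by
    conv_lhs => rw [hx]
    rw [mulVec_add, mulVec_smul, hk, smul_zero, add_zero, add_dotProduct, smul_dotProduct, hvM,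
      smul_zero, add_zero]
  rw [this]
  by_cases h0 : w = 0
  · simp [h0]
  · exact (hq w h0 hwv).le

lemma Hfam_psd {n j : ℕ} {h : Euc n → ℝ} (hC : ContDiffOn ℝ 2 h {(0 : Euc n)}ᶜ) (h1 : Hom1 h)
    (hKpd : ∀ u : Euc n, ‖u‖ = 1 → ∀ w : Euc n, w ≠ 0 → ⟪w, u⟫ = 0 →
      0 < ((EuclideanSpace.equiv (Fin n) ℝ) w) ⬝ᵥ
        ((hessMat h u).mulVec ((EuclideanSpace.equiv (Fin n) ℝ) w)))
    {u : Euc n} (hu : ‖u‖ = 1) (k : Fin n) : (hessMat (Hfam n j h k) u).PosSemidef := by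
  by_cases hk : (k : ℕ) < n - 1
  · exact psd_of_kill (hessMat_symm (C2at (Hfam_C2 hC k) hu)) (unit_dot hu)
      (hom1_hess_kill (Hfam_hom h1 k hk) (C2at (Hfam_C2 hC k) hu))
      (fun w hw hwu => Hfam_quad hKpd hu k hk w hw hwu)
  · have : Hfam n j h k = fun x => (1 / 2) * ‖x‖ ^ 2 := by rw [Hfam, if_neg hk]
    rw [this, hessMat_const_mul _ (contDiff_norm_sq ℝ).contDiffAt, hessMat_normsq, smul_smul]
    norm_num
    exact PosSemidef.one

lemma mixedCurv_eq {n j : ℕ} (hn : 3 ≤ n) {h : Euc n → ℝ}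
    (hC : ContDiffOn ℝ 2 h {(0 : Euc n)}ᶜ) (h1 : Hom1 h) {z : Euc n → ℝ}
    (hz : ContDiffOn ℝ 2 z {(0 : Euc n)}ᶜ) (hz1 : ∀ c : ℝ, 0 < c → ∀ x, z (c • x) = z x)
    {u : Euc n} (hu : ‖u‖ = 1) :
    mixedCurv n (curvListZ n j h z) u
      = n * Qf n j h ⟨0, by omega⟩ (fun x => z x * h x) u := by
  have hu0 : u.ofLp ≠ 0 := by
    intro h0
    have : u = 0 := by ext i; exact congrFun h0 i
    rw [this] at hu; simp at hu
  rw [mixedCurv, mixedDisc_eq, Qf]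
  congr 1
  set i0 : Fin n := ⟨0, by omega⟩ with hi0
  set L : Fin n := ⟨n - 1, by omega⟩ with hL
  have hiL : i0 ≠ L := by
    rw [hi0, hL]; intro h; have := congrArg Fin.val h; simp at this; omega
  set A := Function.update (fun k => hessMat (Hfam n j h k) u) i0
    (hessMat (fun x => z x * h x) u) with hA
  have hkL : ∀ k : Fin n, k ≠ L → (k : ℕ) < n - 1 := by
    intro k hk
    have := k.isLt
    by_contra hcon
    apply hk
    ext
    simp [hL]; omega
  have e1 : (fun i : Fin n =>
      if h' : (i : ℕ) < n - 1 then hessMat (curvListZ n j h z ⟨i, h'⟩) u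
      else Matrix.of fun a b =>
        (EuclideanSpace.equiv (Fin n) ℝ) u a * (EuclideanSpace.equiv (Fin n) ℝ) u b)
      = Function.update A L (vecMulVec u.ofLp u.ofLp) := by
    ext1 k
    by_cases hk : k = L
    · rw [hk, Function.update_self, dif_neg (by simp [hL])]
      ext a b
      simp [vecMulVec_apply]
    · rw [Function.update_of_ne hk, dif_pos (hkL k hk), hA]
      by_cases hk0 : k = i0
      · have hkv : (k : ℕ) = 0 := by rw [hk0]
        rw [show Function.update (fun k => hessMat (Hfam n j h k) u) i0
          (hessMat (fun x => z x * h x) u) k = hessMat (fun x => z x * h x) u from by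
            rw [hk0, Function.update_self]]
        simp [curvListZ, hkv]
      · rw [Function.update_of_ne hk0]
        have : (k : ℕ) ≠ 0 := fun h => hk0 (by ext; simp [hi0, h])
        simp [curvListZ, Hfam, this, hkL k hk]
  have hAL : A L = 1 := by
    rw [hA, Function.update_of_ne hiL.symm]
    have : Hfam n j h L = fun x => (1 / 2) * ‖x‖ ^ 2 := by rw [Hfam, if_neg (by simp [hL])]
    rw [this, hessMat_const_mul _ (contDiff_norm_sq ℝ).contDiffAt, hessMat_normsq, smul_smul]
    norm_num
  have hAk : ∀ k, k ≠ L → A k *ᵥ u.ofLp = 0 := by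
    intro k hk
    by_cases hk0 : k = i0
    · rw [hk0, hA, Function.update_self]
      refine hom1_hess_kill ?_ ((C2at hz hu).mul (C2at hC hu))
      intro c hc x
      show z (c • x) * h (c • x) = c * (z x * h x)
      rw [hz1 c hc, h1 c hc]; ring
    · rw [hA, Function.update_of_ne hk0]
      exact hom1_hess_kill (Hfam_hom h1 k (hkL k hk)) (C2at (Hfam_C2 hC k) hu)
  have e2 : A = Function.update A L (vecMulVec u.ofLp u.ofLp + (1 - vecMulVec u.ofLp u.ofLp)) := by
    rw [add_sub_cancel, ← hAL, Function.update_eq_self]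
  rw [e1]
  conv_rhs => rw [e2]
  rw [MultilinearMap.map_update_add]
  have : mdML n (Function.update A L (1 - vecMulVec u.ofLp u.ofLp)) = 0 := by
    refine md_kill _ u.ofLp hu0 fun k => ?_
    by_cases hk : k = L
    · rw [hk, Function.update_self, sub_mulVec, one_mulVec, vecMulVec_mulVec, unit_dot hu]
      simp
    · rw [Function.update_of_ne hk]; exact hAk k hk
  rw [this, add_zero]

lemma curvListZ_one {n j : ℕ} (hj : 2 ≤ j) (h : Euc n → ℝ) :
    curvListZ n j h (fun _ => 1) = curvList n j h := by
  ext i x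
  simp only [curvListZ, curvList, one_mul]
  by_cases hi : (i : ℕ) = 0
  · rw [if_pos hi, if_pos (by omega)]
  · rw [if_neg hi]

lemma mixedCurv_eq' {n j : ℕ} (hn : 3 ≤ n) (hj : 2 ≤ j) {h : Euc n → ℝ}
    (hC : ContDiffOn ℝ 2 h {(0 : Euc n)}ᶜ) (h1 : Hom1 h)
    {u : Euc n} (hu : ‖u‖ = 1) :
    mixedCurv n (curvList n j h) u = n * Qf n j h ⟨0, by omega⟩ h u := by
  rw [← curvListZ_one hj, mixedCurv_eq hn hC h1 contDiffOn_const (fun _ _ _ => rfl) hu]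
  simp only [one_mul]

lemma mixedCurv_pos {n j : ℕ} (hn : 3 ≤ n) {h : Euc n → ℝ}
    (hC : ContDiffOn ℝ 2 h {(0 : Euc n)}ᶜ) (h1 : Hom1 h)
    (hKpd : ∀ u : Euc n, ‖u‖ = 1 → ∀ w : Euc n, w ≠ 0 → ⟪w, u⟫ = 0 →
      0 < ((EuclideanSpace.equiv (Fin n) ℝ) w) ⬝ᵥ
        ((hessMat h u).mulVec ((EuclideanSpace.equiv (Fin n) ℝ) w)))
    {u : Euc n} (hu : ‖u‖ = 1) : 0 < mixedCurv n (curvList n j h) u := by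
  rw [mixedCurv, mixedDisc_eq]
  have hn0 : (0 : ℝ) < n := by exact_mod_cast (by omega : 0 < n)
  refine mul_pos hn0 ?_
  set L : Fin n := ⟨n - 1, by omega⟩ with hL
  have hkL : ∀ k : Fin n, k ≠ L → (k : ℕ) < n - 1 := by
    intro k hk
    have := k.isLt
    by_contra hcon
    apply hk
    ext
    simp [hL]; omega
  have e : ∀ k (hk : k ≠ L), (if h' : (k : ℕ) < n - 1 then hessMat (curvList n j h ⟨k, h'⟩) u
      else Matrix.of fun a b =>
        (EuclideanSpace.equiv (Fin n) ℝ) u a * (EuclideanSpace.equiv (Fin n) ℝ) u b)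
      = hessMat (Hfam n j h k) u := by
    intro k hk
    rw [dif_pos (hkL k hk)]
    simp [curvList, Hfam, hkL k hk]
  refine md_pos _ u.ofLp (unit_dot hu) L ?_ ?_ ?_ ?_
  · rw [dif_neg (by simp [hL])]
    ext a b
    simp [vecMulVec_apply]
  · intro k hk
    rw [e k hk]
    simpa [IsHermitian] using hessMat_symm (C2at (Hfam_C2 hC k) hu)
  · intro k hk
    rw [e k hk]
    exact hom1_hess_kill (Hfam_hom h1 k (hkL k hk)) (C2at (Hfam_C2 hC k) hu)
  · intro k hk w hw hwu
    rw [e k hk]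
    exact Hfam_quad hKpd hu k (hkL k hk) w hw hwu

lemma Qf_cont {n j : ℕ} {h : Euc n → ℝ} (hC : ContDiffOn ℝ 2 h {(0 : Euc n)}ᶜ) (i0 : Fin n)
    {f : Euc n → ℝ} (hf : ContDiffOn ℝ 2 f {(0 : Euc n)}ᶜ) :
    ContinuousOn (Qf n j h i0 f) {(0 : Euc n)}ᶜ := by
  refine (md_continuous n).comp_continuousOn ?_
  refine continuousOn_pi.mpr fun k => ?_
  by_cases hk : k = i0
  · subst hk
    simp only [Function.update_self]
    exact hessMat_continuousOn isOpen_compl_singleton hf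
  · simp only [Function.update_of_ne hk]
    exact hessMat_continuousOn isOpen_compl_singleton (Hfam_C2 hC k)

lemma sph_sub (n : ℕ) : sphere (0 : Euc n) 1 ⊆ {(0 : Euc n)}ᶜ := by
  intro x hx h0
  rw [Set.mem_singleton_iff] at h0
  simp [h0] at hx

lemma cont_int {n : ℕ} (hn : 1 ≤ n) {G : Euc n → ℝ} (hG : ContinuousOn G {(0 : Euc n)}ᶜ) :
    Integrable G (sphM n) := by
  have := sphM_finite n hn
  have hG' := hG.mono (sph_sub n)
  obtain ⟨C, hC⟩ := (isCompact_sphere (0 : Euc n) 1).exists_bound_of_continuousOn hG'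
  refine Integrable.of_bound (C := C)
    (hG'.aestronglyMeasurable isClosed_sphere.measurableSet) ?_
  filter_upwards [sphM_ae n] with x hx using hC x (by simpa using hx)

lemma Qf_symm {n j : ℕ} (hn : 3 ≤ n) {h : Euc n → ℝ}
    (hC : ContDiffOn ℝ 2 h {(0 : Euc n)}ᶜ) (h1 : Hom1 h) {f g : Euc n → ℝ}
    (hf : ContDiffOn ℝ 2 f {(0 : Euc n)}ᶜ) (hg : ContDiffOn ℝ 2 g {(0 : Euc n)}ᶜ)
    (hf1 : Hom1 f) (hg1 : Hom1 g) :
    ∫ u, (f u * Qf n j h ⟨0, by omega⟩ g u - g u * Qf n j h ⟨0, by omega⟩ f u) ∂(sphM n) = 0 := by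
  refine sph_symm n f g (Hfam n j h) ⟨0, by omega⟩ ⟨n - 1, by omega⟩ ?_ hf hg hf1 hg1
    (fun k _ => Hfam_C2 hC k) ?_ ?_
  · intro h; have := congrArg Fin.val h; simp at this; omega
  · intro k hk
    apply Hfam_hom h1
    have := k.isLt
    by_contra hcon
    apply hk
    ext
    simp; omega
  · rw [Hfam, if_neg (by simp)]

lemma Qf_carre {n j : ℕ} {h : Euc n → ℝ} (i0 : Fin n) 
    (hC : ContDiffOn ℝ 2 h {(0 : Euc n)}ᶜ) (h1 : Hom1 h)
    (hKpd : ∀ u : Euc n, ‖u‖ = 1 → ∀ w : Euc n, w ≠ 0 → ⟪w, u⟫ = 0 →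
      0 < ((EuclideanSpace.equiv (Fin n) ℝ) w) ⬝ᵥ
        ((hessMat h u).mulVec ((EuclideanSpace.equiv (Fin n) ℝ) w)))
    {z : Euc n → ℝ} (hz : ContDiffOn ℝ 2 z {(0 : Euc n)}ᶜ)
    {u : Euc n} (hu : ‖u‖ = 1) (hp : 0 ≤ h u) :
    0 ≤ Qf n j h i0 (fun x => (z x * z x) * h x) u - 2 * z u * Qf n j h i0 (fun x => z x * h x) u
      + z u ^ 2 * Qf n j h i0 h u := by
  have hzu := C2at hz hu
  have hhu := C2at hC hu
  have hzd := hzu.differentiableAt (by norm_num)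
  have hnn : 0 ≤ mdML n (Function.update (fun k => hessMat (Hfam n j h k) u) i0
      (vecMulVec (gradv z u) (gradv z u))) := by
    apply md_nonneg
    intro k
    by_cases hk : k = i0
    · rw [hk, Function.update_self]
      have := posSemidef_vecMulVec_self_star (gradv z u)
      simpa using this
    · rw [Function.update_of_ne hk]
      exact Hfam_psd hC h1 hKpd hu k
  unfold Qf
  rw [hessMat_mul (hzu.mul hzu) hhu, hessMat_mul hzu hzu, hessMat_mul hzu hhu, gradv_mul hzd hzd]
  simp only [add_vecMulVec, vecMulVec_add, smul_vecMulVec, vecMulVec_smul, smul_add,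
    MultilinearMap.map_update_add, MultilinearMap.map_update_smul, smul_eq_mul]
  have := mul_nonneg hp hnn
  linarith

lemma Qf_const_mul {n j : ℕ} {h : Euc n → ℝ} (i0 : Fin n) (c : ℝ) {f : Euc n → ℝ} {u : Euc n}
    (hf : ContDiffAt ℝ 2 f u) :
    Qf n j h i0 (fun x => c * f x) u = c * Qf n j h i0 f u := by
  unfold Qf
  rw [hessMat_const_mul c hf, MultilinearMap.map_update_smul, smul_eq_mul]

lemma hom1_mul {n : ℕ} {h z : Euc n → ℝ} (h1 : Hom1 h)
    (hz1 : ∀ c : ℝ, 0 < c → ∀ x, z (c • x) = z x) : Hom1 (fun x => z x * h x) := by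
  intro c hc x
  show z (c • x) * h (c • x) = c * (z x * h x)
  rw [hz1 c hc, h1 c hc]; ring

lemma integral_VKj {n j : ℕ} (hn : 3 ≤ n) (hj : 2 ≤ j) {h : Euc n → ℝ}
    (hC : ContDiffOn ℝ 2 h {(0 : Euc n)}ᶜ) (h1 : Hom1 h)
    (hpos : ∀ u : Euc n, ‖u‖ = 1 → 0 < h u)
    (hsp : ∀ u : Euc n, ‖u‖ = 1 → 0 < mixedCurv n (curvList n j h) u)
    {z : Euc n → ℝ} (hz : C2Sphere z) (y : Euc n → ℝ) :
    ∫ u, y u * TKj n j h z u ∂(VKj n j h)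
      = ∫ u, (y u * h u) * (z u * Qf n j h ⟨0, by omega⟩ h u
          - Qf n j h ⟨0, by omega⟩ (fun x => z x * h x) u) ∂(sphM n) := by
  have hn0 : (0 : ℝ) < n := by exact_mod_cast (by omega : 0 < n)
  have hm : AEMeasurable (fun u => ENNReal.ofReal ((n : ℝ)⁻¹ * h u * mixedCurv n (curvList n j h) u))
      (sphM n) := by
    have hI : Integrable (fun u => h u * Qf n j h ⟨0, by omega⟩ h u) (sphM n) :=
      cont_int (by omega) (hC.continuousOn.mul (Qf_cont hC _ hC))
    refine (hI.aestronglyMeasurable.aemeasurable.ennreal_ofReal).congr ?_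
    filter_upwards [sphM_ae n] with u hu
    rw [mixedCurv_eq' hn hj hC h1 hu]
    congr 1
    field_simp
  rw [VKj, integral_withDensity_eq_integral_toReal_smul₀ hm
    (Filter.Eventually.of_forall fun _ => ENNReal.ofReal_lt_top)]
  refine integral_congr_ae ?_
  filter_upwards [sphM_ae n] with u hu
  have hs := hsp u hu
  have hh := hpos u hu
  rw [ENNReal.toReal_ofReal (by positivity), smul_eq_mul, TKj,
    mixedCurv_eq hn hC h1 hz.1 hz.2 hu]
  have e := mixedCurv_eq' hn hj hC h1 hu (j := j)
  rw [e] at hs ⊢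
  have hq : 0 < Qf n j h ⟨0, by omega⟩ h u := pos_of_mul_pos_right hs hn0.le
  field_simp

/-- The operator `T_K^j` annihilates constants, is symmetric with respect to the
`L²(V_K^j)` inner product, and is positive semi-definite. -/
theorem TKj_properties (n j : ℕ) (hn : 3 ≤ n) (hj2 : 2 ≤ j) (hjn : j ≤ n - 1)
    (K : Set (Euc n)) (hKcp : IsCompact K) (hKcv : Convex ℝ K)
    (hKint : (interior K).Nonempty) (hKs : ∀ x ∈ K, -x ∈ K)
    (hKsm : ContDiffOn ℝ 2 (suppFn K) {(0 : Euc n)}ᶜ)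
    (hKpd : ∀ u : Euc n, ‖u‖ = 1 → ∀ w : Euc n, w ≠ 0 → ⟪w, u⟫ = 0 →
      0 < ((EuclideanSpace.equiv (Fin n) ℝ) w) ⬝ᵥ
        ((hessMat (suppFn K) u).mulVec ((EuclideanSpace.equiv (Fin n) ℝ) w))) :
    (∀ c : ℝ, ∀ u : Euc n, ‖u‖ = 1 → TKj n j (suppFn K) (fun _ => c) u = 0) ∧
    (∀ z₁ z₂ : Euc n → ℝ, C2Sphere z₁ → C2Sphere z₂ →
      ∫ u, z₁ u * TKj n j (suppFn K) z₂ u ∂(VKj n j (suppFn K))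
        = ∫ u, z₂ u * TKj n j (suppFn K) z₁ u ∂(VKj n j (suppFn K))) ∧
    (∀ z : Euc n → ℝ, C2Sphere z →
      0 ≤ ∫ u, z u * TKj n j (suppFn K) z u ∂(VKj n j (suppFn K))) := by
  have hC := hKsm
  have h1 : Hom1 (suppFn K) := suppFn_hom1 K
  have hpos : ∀ u : Euc n, ‖u‖ = 1 → 0 < suppFn K u := by
    intro u hu
    refine suppFn_pos K hKcp hKint hKs ?_
    rintro rfl
    simp at hu
  have hsp : ∀ u : Euc n, ‖u‖ = 1 → 0 < mixedCurv n (curvList n j (suppFn K)) u :=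
    fun u hu => mixedCurv_pos hn hC h1 hKpd hu
  have hterm : ∀ z₁ z₂ : Euc n → ℝ, C2Sphere z₁ → C2Sphere z₂ →
      Integrable (fun u => (z₁ u * suppFn K u) * (z₂ u * Qf n j (suppFn K) ⟨0, by omega⟩ (suppFn K) u
          - Qf n j (suppFn K) ⟨0, by omega⟩ (fun x => z₂ x * suppFn K x) u)) (sphM n) := by
    intro z₁ z₂ hz₁ hz₂
    refine cont_int (by omega) ((hz₁.1.continuousOn.mul hC.continuousOn).mul
      ((hz₂.1.continuousOn.mul (Qf_cont hC _ hC)).sub (Qf_cont hC _ (hz₂.1.mul hC))))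
  refine ⟨?_, ?_, ?_⟩
  · intro c u hu
    have hs := hsp u hu
    rw [TKj, mixedCurv_eq hn hC h1 contDiffOn_const (fun _ _ _ => rfl) hu,
      Qf_const_mul _ c (C2at hC hu)]
    rw [mixedCurv_eq' hn hj2 hC h1 hu] at hs ⊢
    rw [mul_left_comm, mul_div_assoc, div_self hs.ne', mul_one, sub_self]
  · intro z₁ z₂ hz₁ hz₂
    rw [integral_VKj hn hj2 hC h1 hpos hsp hz₂, integral_VKj hn hj2 hC h1 hpos hsp hz₁, ← sub_eq_zero,
      ← integral_sub (hterm z₁ z₂ hz₁ hz₂) (hterm z₂ z₁ hz₂ hz₁)]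
    rw [← Qf_symm (j := j) hn hC h1 (hz₂.1.mul hC) (hz₁.1.mul hC) (hom1_mul h1 hz₂.2)
      (hom1_mul h1 hz₁.2)]
    refine integral_congr_ae (Filter.Eventually.of_forall fun u => ?_)
    simp only
    ring
  · intro z hz
    rw [integral_VKj hn hj2 hC h1 hpos hsp hz]
    have hzz : ContDiffOn ℝ 2 (fun x => (z x * z x) * suppFn K x) {(0 : Euc n)}ᶜ :=
      (hz.1.mul hz.1).mul hC
    have hsym := Qf_symm (j := j) hn hC h1 hC hzz h1
      (hom1_mul (z := fun x => z x * z x) h1 (fun c hc x => by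
        show z (c • x) * z (c • x) = z x * z x
        rw [hz.2 c hc]))
    have hI2 : Integrable (fun u => suppFn K u * Qf n j (suppFn K) ⟨0, by omega⟩
        (fun x => (z x * z x) * suppFn K x) u - (z u * z u) * suppFn K u *
          Qf n j (suppFn K) ⟨0, by omega⟩ (suppFn K) u) (sphM n) :=
      cont_int (by omega) ((hC.continuousOn.mul (Qf_cont hC _ hzz)).sub
        (hzz.continuousOn.mul (Qf_cont hC _ hC)))
    have hI1 := (hterm z z hz hz).const_mul 2
    have key : 0 ≤ ∫ u, (2 * ((z u * suppFn K u) * (z u * Qf n j (suppFn K) ⟨0, by omega⟩ (suppFn K) u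
          - Qf n j (suppFn K) ⟨0, by omega⟩ (fun x => z x * suppFn K x) u))
        + (suppFn K u * Qf n j (suppFn K) ⟨0, by omega⟩
        (fun x => (z x * z x) * suppFn K x) u - (z u * z u) * suppFn K u *
          Qf n j (suppFn K) ⟨0, by omega⟩ (suppFn K) u)) ∂(sphM n) := by
      refine integral_nonneg_of_ae ?_
      filter_upwards [sphM_ae n] with u hu
      have hp := (hpos u hu).le
      have := mul_nonneg hp (Qf_carre (j := j) ⟨0, by omega⟩ hC h1 hKpd hz.1 hu hp)
      simp only [Pi.zero_apply]
      linarith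
    rw [integral_add hI1 hI2, hsym, integral_const_mul] at key
    linarith

end
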